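/- Let F ⊆ (ω)^ω be a game filter, s ∈ (ℕ) and X ∈ F with s ⪯ X, and suppose D ⊆ (ω)^{0*}_s is 0-dense in (X)^{0*}_s. Then there are r, t ∈ (ℕ) with r* ⪯ t and t ∈ (X)^{1*}_s, and Y ∈ (t,X) ∩ F, such that r ∈ D and the set {u ∈ (ℕ) : t ⪯ u and (u)^0_s ⊆ D} is 1-dense in (t,Y)^{1*}_s. -/

import Mathlib

namespace DualRamsey

/-- A partition: a set of pairwise disjoint nonempty blocks (subsets of ℕ). -/
def IsPartition (P : Set (Set ℕ)) : Prop :=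
  (∀ b ∈ P, b.Nonempty) ∧ ∀ b ∈ P, ∀ c ∈ P, b ≠ c → Disjoint b c

/-- The domain of a partition: the union of its blocks. -/
def pdom (P : Set (Set ℕ)) : Set ℕ := ⋃₀ P

/-- Membership in (ω)^ω : an infinite partition of ℕ. -/
def InfPart (X : Set (Set ℕ)) : Prop :=
  IsPartition X ∧ pdom X = Set.univ ∧ X.Infinite

/-- Membership in (ℕ) : a partition whose domain is {0, …, n−1} for some n. -/
def FinPart (s : Set (Set ℕ)) : Prop :=
  IsPartition s ∧ ∃ n : ℕ, pdom s = Set.Iio n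

/-- `Coarser P Q` means P ⊑ Q : P is coarser than Q, i.e. every block p of P satisfies
that p ∩ dom(Q) is a union of sets of the form q ∩ dom(P) with q a block of Q. -/
def Coarser (P Q : Set (Set ℕ)) : Prop :=
  ∀ p ∈ P, ∃ S ⊆ Q, p ∩ pdom Q = ⋃ q ∈ S, q ∩ pdom P

/-- `Segment s X` means s ⪯ X : for every block p of s there is a block q of X
with p = q ∩ dom(s). -/
def Segment (s X : Set (Set ℕ)) : Prop :=
  ∀ p ∈ s, ∃ q ∈ X, p = q ∩ pdom s

/-- For s ∈ (ℕ) with dom(s) = {0,…,n−1}, this is the number n. -/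
noncomputable def finBound (s : Set (Set ℕ)) : ℕ := sInf {n | pdom s = Set.Iio n}

/-- s* := s ∪ {{n}} where dom(s) = {0,…,n−1}. -/
noncomputable def sStar (s : Set (Set ℕ)) : Set (Set ℕ) := insert {finBound s} s

/-- The dual Ellentuck neighbourhood (s,X) := {Y ∈ (ω)^ω : s ⪯ Y and Y ⊑ X}. -/
def EllNbhd (s X : Set (Set ℕ)) : Set (Set (Set ℕ)) :=
  {Y | InfPart Y ∧ Segment s Y ∧ Coarser Y X}

/-- (s,X)^n := {u ∈ (ℕ) : |u| = n, s ⪯ u, u* ⊑ X}. -/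
def nseg (s X : Set (Set ℕ)) (n : ℕ) : Set (Set (Set ℕ)) :=
  {u | FinPart u ∧ u.ncard = n ∧ Segment s u ∧ Coarser (sStar u) X}

/-- (s,ω)^n := {u ∈ (ℕ) : |u| = n, s ⪯ u} (ω viewed as the partition into singletons). -/
def nsegOmega (s : Set (Set ℕ)) (n : ℕ) : Set (Set (Set ℕ)) :=
  {u | FinPart u ∧ u.ncard = n ∧ Segment s u}

/-- a and b lie in a common block of P. -/
def sameBlock (P : Set (Set ℕ)) (a b : ℕ) : Prop := ∃ p ∈ P, a ∈ p ∧ b ∈ p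

/-- P ⊓ Q : the finest partition coarser than both P and Q, with
dom(P ⊓ Q) = dom(P) ∪ dom(Q); its blocks are the classes of the equivalence
relation generated by "lying in a common block of P or of Q". -/
def pmeet (P Q : Set (Set ℕ)) : Set (Set ℕ) :=
  {b | ∃ a ∈ pdom P ∪ pdom Q,
    b = {c | Relation.EqvGen (fun u v => sameBlock P u v ∨ sameBlock Q u v) a c}}

/-- P ⊑* Q : P is almost coarser than Q, i.e. there is a partition R with finite
domain such that R ⊓ P ⊑ Q. -/
def AlmostCoarser (P Q : Set (Set ℕ)) : Prop :=
  ∃ R, IsPartition R ∧ (pdom R).Finite ∧ Coarser (pmeet R P) Q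

/-- A filter on (ω)^ω. -/
structure IsPFilter (F : Set (Set (Set ℕ))) : Prop where
  mem_infPart : ∀ X ∈ F, InfPart X
  empty_not_mem : ∅ ∉ F
  upward : ∀ X ∈ F, ∀ Y, InfPart Y → Coarser X Y → Y ∈ F
  meet_infPart : ∀ X ∈ F, ∀ Y ∈ F, InfPart (pmeet X Y)
  meet_mem : ∀ X ∈ F, ∀ Y ∈ F, pmeet X Y ∈ F

/-- An ultrafilter on (ω)^ω : a filter not properly contained in any other filter. -/
def IsPUltrafilter (F : Set (Set (Set ℕ))) : Prop :=
  IsPFilter F ∧ ∀ G, IsPFilter G → F ⊆ G → F = G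

/-- The segment colouring property. -/
def HasSCP (F : Set (Set (Set ℕ))) : Prop :=
  ∀ s, FinPart s → ∀ X ∈ F, Coarser s X → ∀ k r : ℕ, 1 ≤ s.ncard + k → 1 ≤ r →
    ∀ π : Set (Set ℕ) → ℕ, (∀ u ∈ nseg s X (s.ncard + k), π u < r) →
      ∃ Y ∈ EllNbhd s X, Y ∈ F ∧
        ∀ u ∈ nseg s Y (s.ncard + k), ∀ v ∈ nseg s Y (s.ncard + k), π u = π v

/-- `IsLCondWith E p s Xw` : p is an L*_E-condition with stem s and witness family Xw. -/
def IsLCondWith (E : Set (Set (Set ℕ))) (p : Set (Set (Set ℕ))) (s : Set (Set ℕ))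
    (Xw : Set (Set ℕ) → Set (Set ℕ)) : Prop :=
  (∀ t ∈ p, FinPart t) ∧
  s ∈ p ∧ (∀ t ∈ p, Segment s t) ∧
  (∀ t ∈ p, Xw t ∈ E) ∧
  (∀ t ∈ p, Coarser (sStar t) (Xw t)) ∧
  (∀ t ∈ p, {u | u ∈ p ∧ Segment t u ∧ u.ncard = t.ncard + 1}
      = nseg (sStar t) (Xw t) (t.ncard + 1)) ∧
  (∀ t ∈ p, ∀ u ∈ p, Segment t u → EllNbhd u (Xw u) ⊆ EllNbhd t (Xw t)) ∧
  (∀ t ∈ p, ∀ u ∈ p, pdom t = pdom u → Coarser t u → Xw t = Xw u)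

/-- X is a branch of the condition p with stem s. -/
def IsBranch (p : Set (Set (Set ℕ))) (s : Set (Set ℕ)) (X : Set (Set ℕ)) : Prop :=
  ∀ t, FinPart t → Segment s t → Coarser (sStar t) X → t ∈ p

/-- F is diagonalizable: every L*_F-condition has a branch in F. -/
def Diagonalizable (F : Set (Set (Set ℕ))) : Prop :=
  ∀ p s Xw, IsLCondWith F p s Xw → ∃ X ∈ F, IsBranch p s X

/-- A Ramsey* ultrafilter: a diagonalizable scp-filter. -/
def RamseyStar (F : Set (Set (Set ℕ))) : Prop :=
  IsPFilter F ∧ HasSCP F ∧ Diagonalizable F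

/-- O is F-open: a union of nonempty dual Ellentuck neighbourhoods (s,X) with X ∈ F. -/
def FOpen (F O : Set (Set (Set ℕ))) : Prop :=
  ∃ I : Set ((Set (Set ℕ)) × (Set (Set ℕ))),
    (∀ q ∈ I, FinPart q.1 ∧ q.2 ∈ F ∧ (EllNbhd q.1 q.2).Nonempty) ∧
    O = ⋃ q ∈ I, EllNbhd q.1 q.2

/-- (s,X) is good with respect to the F-open set O. -/
def FGood (F O : Set (Set (Set ℕ))) (s X : Set (Set ℕ)) : Prop :=
  ∃ Y ∈ EllNbhd s X, Y ∈ F ∧ EllNbhd s Y ⊆ O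

/-- (s,X) is ugly with respect to O: (t*,X) is bad for every t ∈ (ℕ) with
s ⪯ t*, t* ⊑ X and |t| = |s|. -/
def FUgly (F O : Set (Set (Set ℕ))) (s X : Set (Set ℕ)) : Prop :=
  ∀ t, FinPart t → Segment s (sStar t) → Coarser (sStar t) X → t.ncard = s.ncard →
    ¬ FGood F O (sStar t) X

/-- p is uniform with uniformity witness X (X = cu(p)). -/
def UniformWith (F : Set (Set (Set ℕ))) (p : Set (Set (Set ℕ)))
    (Xw : Set (Set ℕ) → Set (Set ℕ)) (X : Set (Set ℕ)) : Prop :=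
  X ∈ F ∧ ∀ t ∈ p, EllNbhd t X = EllNbhd t (Xw t)

/-- (X) := {Y ∈ (ω)^ω : Y ⊑ X}. -/
def coarsenings (X : Set (Set ℕ)) : Set (Set (Set ℕ)) :=
  {Y | InfPart Y ∧ Coarser Y X}

/-- A ⊆ (ω)^ω has the dual Ramsey property. -/
def IsDualRamsey (A : Set (Set (Set ℕ))) : Prop :=
  ∃ X, InfPart X ∧ (coarsenings X ⊆ A ∨ coarsenings X ∩ A = ∅)

/-- A ⊆ (ω)^ω is completely dual Ramsey. -/
def CompletelyDualRamsey (A : Set (Set (Set ℕ))) : Prop :=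
  ∀ s X, FinPart s → InfPart X → (EllNbhd s X).Nonempty →
    ∃ Y ∈ EllNbhd s X, (EllNbhd s Y ⊆ A ∨ EllNbhd s Y ∩ A = ∅)

/- ### Coding between reals and partitions -/

/-- The hypotheses on the fixed pairing function ♭ : it is (induced by) a bijection
between two-element subsets of ℕ and ℕ. -/
def FlatBijection (flat : ℕ → ℕ → ℕ) : Prop :=
  (∀ m n, flat m n = flat n m) ∧
  (∀ a b c d, a ≠ b → c ≠ d → flat a b = flat c d → ({a, b} : Set ℕ) = {c, d}) ∧
  (∀ k, ∃ a b, a ≠ b ∧ flat a b = k)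

/-- trans(x): the codes ♭({a,b}) of pairs {a,b} connected by a finite chain through x. -/
def ptrans (flat : ℕ → ℕ → ℕ) (x : Set ℕ) : Set ℕ :=
  {k | ∃ m : ℕ, ∃ f : ℕ → ℕ, 1 ≤ m ∧ f 0 ≠ f m ∧ k = flat (f 0) (f m) ∧
    ∀ i < m, flat (f i) (f (i + 1)) ∈ x}

/-- The equivalence relation n ∼ m iff n = m or ♭({n,m}) ∈ trans(x). -/
def cpRel (flat : ℕ → ℕ → ℕ) (x : Set ℕ) (n m : ℕ) : Prop :=
  n = m ∨ flat n m ∈ ptrans flat x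

/-- cp(x): the partition of ℕ whose blocks are the classes of cpRel. -/
def cp (flat : ℕ → ℕ → ℕ) (x : Set ℕ) : Set (Set ℕ) :=
  {b | ∃ n : ℕ, b = {m | cpRel flat x n m}}

/-- pc(X): the partition code of X. -/
def pcode (flat : ℕ → ℕ → ℕ) (X : Set (Set ℕ)) : Set ℕ :=
  {k | ∃ n m, n ≠ m ∧ sameBlock X n m ∧ k = flat n m}

/- ### The game G_F -/

/-- A move of player I: a pair ⟨t, Y⟩. -/
abbrev MoveI := (Set (Set ℕ)) × (Set (Set ℕ))

/-- The play (t, Y, X) follows the strategy σ of player I (σ reads off the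
previous moves of player II). -/
def Follows (σ : List (Set (Set ℕ)) → MoveI) (t Y X : ℕ → Set (Set ℕ)) : Prop :=
  ∀ n, σ (List.ofFn fun i : Fin n => X i) = (t n, Y n)

/-- Player I's n-th move in the play (t,Y,X) is legal. -/
def LegalI (F : Set (Set (Set ℕ))) (t Y X : ℕ → Set (Set ℕ)) (n : ℕ) : Prop :=
  FinPart (t n) ∧ Y n ∈ F ∧ (EllNbhd (sStar (t n)) (Y n)).Nonempty ∧
  ∀ m, n = m + 1 →
    Segment (sStar (t m)) (sStar (t n)) ∧ Coarser (sStar (t n)) (X m) ∧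
    (t n).ncard = (t m).ncard + 1

/-- Player II's n-th move in the play (t,Y,X) is legal. -/
def LegalII (F : Set (Set (Set ℕ))) (t Y X : ℕ → Set (Set ℕ)) (n : ℕ) : Prop :=
  X n ∈ F ∧ X n ∈ EllNbhd (sStar (t n)) (Y n)

/-- σ is a winning strategy for player I in G_F: against legal play of II it always
produces legal moves, and in every legal play following σ player I wins, i.e. any
Y ∈ (ω)^ω with t_n ⪯ Y for all n is not in F. -/
def WinningStratI (F : Set (Set (Set ℕ))) (σ : List (Set (Set ℕ)) → MoveI) : Prop :=
  ∀ t Y X, Follows σ t Y X →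
    (∀ n, (∀ m < n, LegalII F t Y X m) → LegalI F t Y X n) ∧
    ((∀ n, LegalII F t Y X n) →
      ∀ Z, InfPart Z → (∀ n, Segment (t n) Z) → Z ∉ F)

/-- A game filter: an ultrafilter such that player I has no winning strategy in G_F. -/
def GameFilter (F : Set (Set (Set ℕ))) : Prop :=
  IsPUltrafilter F ∧ ∀ σ, ¬ WinningStratI F σ

/- ### Density notions for the appendix -/

/-- (t)^0_s := {u ∈ (ℕ) : dom(u) = dom(t), s ⪯ u, u ⊑ t, |u| = |s|}. -/
def iseg0 (s t : Set (Set ℕ)) : Set (Set (Set ℕ)) :=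
  {u | FinPart u ∧ pdom u = pdom t ∧ Segment s u ∧ Coarser u t ∧ u.ncard = s.ncard}

/-- K ⊆ (ℕ) is dense in (t,X): for every Y ∈ (t,X) ∩ F there is u ∈ K with
t ⪯ u* and u* ⊑ Y. -/
def DenseIn (F : Set (Set (Set ℕ))) (K : Set (Set (Set ℕ))) (t X : Set (Set ℕ)) : Prop :=
  ∀ Y ∈ EllNbhd t X, Y ∈ F → ∃ u ∈ K, Segment t (sStar u) ∧ Coarser (sStar u) Y

/-- D is 0-dense in (X)^{0*}_s: for every Y ∈ (s,X) ∩ F there is u ∈ D with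
s ⪯ u* and u* ⊑ Y. -/
def ZeroDense (F : Set (Set (Set ℕ))) (D : Set (Set (Set ℕ))) (s X : Set (Set ℕ)) : Prop :=
  ∀ Y ∈ EllNbhd s X, Y ∈ F → ∃ u ∈ D, Segment s (sStar u) ∧ Coarser (sStar u) Y

/-- (t,X)^{k*}_s := {u ∈ (ℕ) : t ⪯ u*, u* ⊑ X, |u| = |s| + k}. -/
def tseg (s t X : Set (Set ℕ)) (k : ℕ) : Set (Set (Set ℕ)) :=
  {u | FinPart u ∧ Segment t (sStar u) ∧ Coarser (sStar u) X ∧ u.ncard = s.ncard + k}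

/-- E is k-dense in (t,X)^{k*}_s: for every Y ∈ (t,X) ∩ F, (t,Y)^{k*}_s ∩ E ≠ ∅. -/
def KDense (F : Set (Set (Set ℕ))) (E : Set (Set (Set ℕ))) (s t X : Set (Set ℕ))
    (k : ℕ) : Prop :=
  ∀ Y ∈ EllNbhd t X, Y ∈ F → (tseg s t Y k ∩ E).Nonempty

lemma sameBlock_symm {P : Set (Set ℕ)} {a b : ℕ} (h : sameBlock P a b) : sameBlock P b a := by
  obtain ⟨p, hp, ha, hb⟩ := h
  exact ⟨p, hp, hb, ha⟩

lemma block_eq_of_mem {P : Set (Set ℕ)} (hP : IsPartition P) {p q : Set ℕ} (hp : p ∈ P)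
    (hq : q ∈ P) {a : ℕ} (hap : a ∈ p) (haq : a ∈ q) : p = q := by
  by_contra hne
  exact Set.disjoint_left.1 (hP.2 p hp q hq hne) hap haq

lemma sameBlock_trans {P : Set (Set ℕ)} (hP : IsPartition P) {a b c : ℕ}
    (h : sameBlock P a b) (h' : sameBlock P b c) : sameBlock P a c := by
  obtain ⟨p, hp, ha, hb⟩ := h
  obtain ⟨q, hq, hb', hc⟩ := h'
  obtain rfl := block_eq_of_mem hP hp hq hb hb'
  exact ⟨p, hp, ha, hc⟩

lemma sameBlock_refl {P : Set (Set ℕ)} {a : ℕ} (ha : a ∈ pdom P) : sameBlock P a a := by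
  obtain ⟨p, hp, hap⟩ := ha
  exact ⟨p, hp, hap, hap⟩

lemma mem_pdom_of_sameBlock {P : Set (Set ℕ)} {a b : ℕ} (h : sameBlock P a b) : a ∈ pdom P := by
  obtain ⟨p, hp, ha, -⟩ := h
  exact ⟨p, hp, ha⟩

lemma mem_block_iff {P : Set (Set ℕ)} (hP : IsPartition P) {p : Set ℕ} (hp : p ∈ P) {a b : ℕ}
    (ha : a ∈ p) : b ∈ p ↔ sameBlock P a b := by
  refine ⟨fun hb => ⟨p, hp, ha, hb⟩, ?_⟩
  rintro ⟨q, hq, haq, hbq⟩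
  rwa [block_eq_of_mem hP hp hq ha haq]

lemma segment_iff {s X : Set (Set ℕ)} (hs : IsPartition s) (hX : IsPartition X) :
    Segment s X ↔ pdom s ⊆ pdom X ∧
      ∀ a ∈ pdom s, ∀ b ∈ pdom s, (sameBlock s a b ↔ sameBlock X a b) := by
  constructor
  · intro h
    refine ⟨?_, ?_⟩
    · rintro a ⟨p, hp, hap⟩
      obtain ⟨q, hq, rfl⟩ := h p hp
      exact ⟨q, hq, hap.1⟩
    · rintro a ⟨p, hp, hap⟩ b hb
      rw [← mem_block_iff hs hp hap]
      obtain ⟨q, hq, rfl⟩ := h p hp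
      rw [← mem_block_iff hX hq hap.1]
      exact ⟨fun h => h.1, fun h => ⟨h, hb⟩⟩
  · rintro ⟨hdom, h⟩ p hp
    obtain ⟨a, ha⟩ := hs.1 p hp
    have has : a ∈ pdom s := ⟨p, hp, ha⟩
    obtain ⟨q, hq, haq⟩ := hdom has
    refine ⟨q, hq, ?_⟩
    ext b
    constructor
    · intro hb
      have hbs : b ∈ pdom s := ⟨p, hp, hb⟩
      exact ⟨(mem_block_iff hX hq haq).2 ((h a has b hbs).1 ((mem_block_iff hs hp ha).1 hb)), hbs⟩
    · rintro ⟨hb, hbs⟩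
      exact (mem_block_iff hs hp ha).2 ((h a has b hbs).2 ((mem_block_iff hX hq haq).1 hb))

lemma coarser_iff {P Q : Set (Set ℕ)} (hP : IsPartition P) (hQ : IsPartition Q)
    (hdom : pdom P ⊆ pdom Q) :
    Coarser P Q ↔ ∀ a ∈ pdom P, ∀ b ∈ pdom P, sameBlock Q a b → sameBlock P a b := by
  constructor
  · rintro h a ⟨p, hp, hap⟩ b hb hab
    obtain ⟨S, hS, hpS⟩ := h p hp
    have haP : a ∈ pdom P := ⟨p, hp, hap⟩
    have ha : a ∈ p ∩ pdom Q := ⟨hap, hdom haP⟩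
    rw [hpS] at ha
    simp only [Set.mem_iUnion] at ha
    obtain ⟨q, hq, haq⟩ := ha
    have hb' : b ∈ p ∩ pdom Q := by
      rw [hpS]
      simp only [Set.mem_iUnion]
      exact ⟨q, hq, (mem_block_iff hQ (hS hq) haq.1).2 hab, hb⟩
    exact ⟨p, hp, hap, hb'.1⟩
  · intro h p hp
    refine ⟨{q ∈ Q | (q ∩ p).Nonempty}, fun q hq => hq.1, ?_⟩
    ext b
    simp only [Set.mem_iUnion]
    constructor
    · rintro ⟨hbp, q, hq, hbq⟩
      exact ⟨q, ⟨hq, b, hbq, hbp⟩, hbq, p, hp, hbp⟩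
    · rintro ⟨q, ⟨hq, a, haq, hap⟩, hbq, hbP⟩
      have haP : a ∈ pdom P := ⟨p, hp, hap⟩
      exact ⟨(mem_block_iff hP hp hap).2 (h a haP b hbP ⟨q, hq, haq, hbq⟩), hdom hbP⟩

lemma FinPart.pdom_eq {s : Set (Set ℕ)} (hs : FinPart s) : pdom s = Set.Iio (finBound s) := by
  obtain ⟨n, hn⟩ := hs.2
  exact Nat.sInf_mem (s := {n | pdom s = Set.Iio n}) ⟨n, hn⟩

lemma finBound_eq {s : Set (Set ℕ)} {n : ℕ} (h : pdom s = Set.Iio n) : finBound s = n := by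
  have h' : pdom s = Set.Iio (finBound s) := Nat.sInf_mem (s := {n | pdom s = Set.Iio n}) ⟨n, h⟩
  exact Set.Iio_injective (h'.symm.trans h)

lemma FinPart.lt_of_sameBlock {s : Set (Set ℕ)} (hs : FinPart s) {a b : ℕ}
    (h : sameBlock s a b) : a < finBound s ∧ b < finBound s := by
  have h1 := mem_pdom_of_sameBlock h
  have h2 := mem_pdom_of_sameBlock (sameBlock_symm h)
  rw [hs.pdom_eq] at h1 h2
  exact ⟨h1, h2⟩

lemma FinPart.refl {s : Set (Set ℕ)} (hs : FinPart s) {a : ℕ} (h : a < finBound s) :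
    sameBlock s a a := sameBlock_refl (by rw [hs.pdom_eq]; exact h)

lemma InfPart.refl {X : Set (Set ℕ)} (hX : InfPart X) (a : ℕ) : sameBlock X a a :=
  sameBlock_refl (by rw [hX.2.1]; trivial)

lemma segment_fin {s t : Set (Set ℕ)} (hs : FinPart s) (ht : FinPart t) :
    Segment s t ↔ finBound s ≤ finBound t ∧
      ∀ a < finBound s, ∀ b < finBound s, (sameBlock s a b ↔ sameBlock t a b) := by
  rw [segment_iff hs.1 ht.1, hs.pdom_eq, ht.pdom_eq, Set.Iio_subset_Iio_iff]
  rfl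

lemma segment_inf {s X : Set (Set ℕ)} (hs : FinPart s) (hX : InfPart X) :
    Segment s X ↔
      ∀ a < finBound s, ∀ b < finBound s, (sameBlock s a b ↔ sameBlock X a b) := by
  rw [segment_iff hs.1 hX.1, hs.pdom_eq, hX.2.1]
  simp

lemma coarser_fin_inf {s X : Set (Set ℕ)} (hs : FinPart s) (hX : InfPart X) :
    Coarser s X ↔
      ∀ a < finBound s, ∀ b < finBound s, sameBlock X a b → sameBlock s a b := by
  rw [coarser_iff hs.1 hX.1 (by rw [hX.2.1]; simp), hs.pdom_eq]
  rfl

lemma coarser_fin {s t : Set (Set ℕ)} (hs : FinPart s) (ht : FinPart t)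
    (h : pdom s = pdom t) : Coarser s t ↔ ∀ a b, sameBlock t a b → sameBlock s a b := by
  rw [coarser_iff hs.1 ht.1 h.le]
  refine ⟨fun H a b hab => H a ?_ b ?_ hab, fun H a _ b _ => H a b⟩
  · rw [h]; exact mem_pdom_of_sameBlock hab
  · rw [h]; exact mem_pdom_of_sameBlock (sameBlock_symm hab)

lemma coarser_inf {Y X : Set (Set ℕ)} (hY : InfPart Y) (hX : InfPart X) :
    Coarser Y X ↔ ∀ a b, sameBlock X a b → sameBlock Y a b := by
  rw [coarser_iff hY.1 hX.1 (by rw [hX.2.1]; simp), hY.2.1]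
  simp

/-- The partition of `A` into the fibres of `f`. -/
def ofFun (f : ℕ → ℕ) (A : Set ℕ) : Set (Set ℕ) :=
  {b | ∃ a ∈ A, b = {c | c ∈ A ∧ f c = f a}}

lemma sameBlock_ofFun {f : ℕ → ℕ} {A : Set ℕ} {a b : ℕ} :
    sameBlock (ofFun f A) a b ↔ a ∈ A ∧ b ∈ A ∧ f a = f b := by
  constructor
  · rintro ⟨_, ⟨c, hc, rfl⟩, ha, hb⟩
    exact ⟨ha.1, hb.1, ha.2.trans hb.2.symm⟩
  · rintro ⟨ha, hb, h⟩
    exact ⟨_, ⟨a, ha, rfl⟩, ⟨ha, rfl⟩, hb, h.symm⟩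

lemma pdom_ofFun (f : ℕ → ℕ) (A : Set ℕ) : pdom (ofFun f A) = A := by
  ext a
  constructor
  · rintro ⟨_, ⟨c, hc, rfl⟩, ha⟩
    exact ha.1
  · intro ha
    exact ⟨_, ⟨a, ha, rfl⟩, ha, rfl⟩

lemma isPartition_ofFun (f : ℕ → ℕ) (A : Set ℕ) : IsPartition (ofFun f A) := by
  constructor
  · rintro _ ⟨a, ha, rfl⟩
    exact ⟨a, ha, rfl⟩
  · rintro _ ⟨a, ha, rfl⟩ _ ⟨b, hb, rfl⟩ hne
    rw [Set.disjoint_left]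
    rintro c ⟨hc, h1⟩ ⟨-, h2⟩
    apply hne
    rw [← h1, ← h2]

lemma finPart_ofFun (f : ℕ → ℕ) (N : ℕ) : FinPart (ofFun f (Set.Iio N)) :=
  ⟨isPartition_ofFun _ _, N, pdom_ofFun _ _⟩

lemma finBound_ofFun (f : ℕ → ℕ) (N : ℕ) : finBound (ofFun f (Set.Iio N)) = N :=
  finBound_eq (pdom_ofFun _ _)

lemma infPart_iff {X : Set (Set ℕ)} :
    InfPart X ↔ IsPartition X ∧ pdom X = Set.univ ∧ ∀ N, ∃ a, ∀ c < N, ¬ sameBlock X a c := by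
  refine ⟨fun h => ⟨h.1, h.2.1, fun N => ?_⟩, fun h => ⟨h.1, h.2.1, fun hfin => ?_⟩⟩
  · by_contra! hcon
    refine h.2.2 (((Set.finite_Iio N).image fun c => {b | sameBlock X c b}).subset ?_)
    intro p hp
    obtain ⟨a, ha⟩ := h.1.1 p hp
    obtain ⟨c, hc, hac⟩ := hcon a
    refine ⟨c, hc, ?_⟩
    have hcp := (mem_block_iff h.1 hp ha).2 hac
    ext b
    exact (mem_block_iff h.1 hp hcp).symm
  · choose! f hf using h.1.1
    obtain ⟨N, hN⟩ := (hfin.image f).bddAbove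
    obtain ⟨a, ha⟩ := h.2.2 (N + 1)
    obtain ⟨p, hp, hap⟩ : a ∈ pdom X := by rw [h.2.1]; trivial
    exact ha (f p) (Nat.lt_succ_of_le (hN ⟨p, hp, rfl⟩)) ⟨p, hp, hap, hf p hp⟩

lemma InfPart.exists_new {X : Set (Set ℕ)} (hX : InfPart X) (N : ℕ) :
    ∃ a, ∀ c < N, ¬ sameBlock X a c := (infPart_iff.1 hX).2.2 N

lemma infPart_ofFun {f : ℕ → ℕ} (h : ∀ N, ∃ a, ∀ c < N, f a ≠ f c) :
    InfPart (ofFun f Set.univ) :=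
  infPart_iff.2 ⟨isPartition_ofFun _ _, pdom_ofFun _ _, fun N => by
    obtain ⟨a, ha⟩ := h N
    exact ⟨a, fun c hc hac => ha c hc (sameBlock_ofFun.1 hac).2.2⟩⟩

lemma eq_of_sameBlock_iff {P Q : Set (Set ℕ)} (hP : IsPartition P) (hQ : IsPartition Q)
    (h : ∀ a b, sameBlock P a b ↔ sameBlock Q a b) : P = Q := by
  have key : ∀ {P Q : Set (Set ℕ)}, IsPartition P → IsPartition Q →
      (∀ a b, sameBlock P a b ↔ sameBlock Q a b) → P ⊆ Q := by
    intro P Q hP hQ h p hp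
    obtain ⟨a, ha⟩ := hP.1 p hp
    obtain ⟨q, hq, haq, -⟩ := (h a a).1 ⟨p, hp, ha, ha⟩
    have : p = q := by
      ext b
      rw [mem_block_iff hP hp ha, mem_block_iff hQ hq haq, h]
    rwa [this]
  exact (key hP hQ h).antisymm (key hQ hP fun a b => (h a b).symm)

lemma pdom_sStar {s : Set (Set ℕ)} (hs : FinPart s) :
    pdom (sStar s) = Set.Iio (finBound s + 1) := by
  have h : pdom (sStar s) = {finBound s} ∪ pdom s := Set.sUnion_insert _ _
  rw [h, hs.pdom_eq]
  ext a
  simp only [Set.mem_union, Set.mem_singleton_iff, Set.mem_Iio]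
  omega

lemma finPart_sStar {s : Set (Set ℕ)} (hs : FinPart s) : FinPart (sStar s) := by
  have hd : ∀ b ∈ s, finBound s ∉ b := fun b hb h => by
    have : finBound s ∈ pdom s := ⟨b, hb, h⟩
    rw [hs.pdom_eq] at this
    exact lt_irrefl _ (Set.mem_Iio.1 this)
  refine ⟨⟨?_, ?_⟩, _, pdom_sStar hs⟩
  · rintro b (rfl | hb)
    · exact Set.singleton_nonempty _
    · exact hs.1.1 b hb
  · rintro b (rfl | hb) c (rfl | hc) hne
    · exact absurd rfl hne
    · exact Set.disjoint_singleton_left.2 (hd c hc)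
    · exact Set.disjoint_singleton_right.2 (hd b hb)
    · exact hs.1.2 b hb c hc hne

lemma finBound_sStar {s : Set (Set ℕ)} (hs : FinPart s) :
    finBound (sStar s) = finBound s + 1 := finBound_eq (pdom_sStar hs)

lemma sameBlock_sStar {s : Set (Set ℕ)} {a b : ℕ} :
    sameBlock (sStar s) a b ↔ sameBlock s a b ∨ (a = finBound s ∧ b = finBound s) := by
  constructor
  · rintro ⟨p, rfl | hp, ha, hb⟩
    · exact Or.inr ⟨ha, hb⟩
    · exact Or.inl ⟨p, hp, ha, hb⟩
  · rintro (⟨p, hp, ha, hb⟩ | ⟨rfl, rfl⟩)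
    · exact ⟨p, Or.inr hp, ha, hb⟩
    · exact ⟨_, Or.inl rfl, rfl, rfl⟩

lemma FinPart.finite {s : Set (Set ℕ)} (hs : FinPart s) : s.Finite := by
  refine ((Set.finite_Iio (finBound s)).finite_subsets).subset fun p hp => ?_
  rw [Set.mem_ofPred_eq, ← hs.pdom_eq]
  exact Set.subset_sUnion_of_mem hp

lemma ncard_sStar {s : Set (Set ℕ)} (hs : FinPart s) : (sStar s).ncard = s.ncard + 1 := by
  refine Set.ncard_insert_of_notMem (fun h => ?_) hs.finite
  have : finBound s ∈ pdom s := ⟨_, h, rfl⟩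
  rw [hs.pdom_eq] at this
  exact lt_irrefl _ (Set.mem_Iio.1 this)

lemma ncard_eq_iff {s t : Set (Set ℕ)} (hs : FinPart s) (ht : FinPart t) (hst : Segment s t) :
    t.ncard = s.ncard ↔ ∀ a < finBound t, ∃ c < finBound s, sameBlock t a c := by
  choose! f hf hpf using hst
  have hinj : Set.InjOn f s := fun p hp q hq h => by rw [hpf p hp, hpf q hq, h]
  have himg : f '' s ⊆ t := by
    rintro _ ⟨p, hp, rfl⟩
    exact hf p hp
  rw [← hinj.ncard_image]
  have h1 : t.ncard = (f '' s).ncard ↔ f '' s = t :=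
    ⟨fun h => Set.eq_of_subset_of_ncard_le himg h.le ht.finite, fun h => by rw [h]⟩
  rw [h1]
  constructor
  · intro h a ha
    obtain ⟨q, hq, haq⟩ : a ∈ pdom t := by rw [ht.pdom_eq]; exact ha
    rw [← h] at hq
    obtain ⟨p, hp, rfl⟩ := hq
    obtain ⟨c, hc⟩ := hs.1.1 p hp
    have hcs : c ∈ pdom s := ⟨p, hp, hc⟩
    rw [hs.pdom_eq] at hcs
    rw [hpf p hp] at hc
    exact ⟨c, hcs, f p, hf p hp, haq, hc.1⟩
  · intro h
    refine himg.antisymm fun q hq => ?_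
    obtain ⟨a, ha⟩ := ht.1.1 q hq
    have hat : a ∈ pdom t := ⟨q, hq, ha⟩
    rw [ht.pdom_eq] at hat
    obtain ⟨c, hc, hac⟩ := h a hat
    obtain ⟨p, hp, hcp⟩ : c ∈ pdom s := by rw [hs.pdom_eq]; exact hc
    refine ⟨p, hp, ?_⟩
    rw [hpf p hp] at hcp
    exact block_eq_of_mem ht.1 (hf p hp) hq hcp.1 ((mem_block_iff ht.1 hq ha).2 hac)

/-- The least element of the block of `a`. -/
noncomputable def rep (P : Set (Set ℕ)) (a : ℕ) : ℕ := sInf {c | sameBlock P a c}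

lemma sameBlock_rep {P : Set (Set ℕ)} {a : ℕ} (h : sameBlock P a a) :
    sameBlock P a (rep P a) := Nat.sInf_mem (s := {c | sameBlock P a c}) ⟨a, h⟩

lemma rep_le {P : Set (Set ℕ)} {a c : ℕ} (h : sameBlock P a c) : rep P a ≤ c := Nat.sInf_le h

lemma rep_eq_iff {P : Set (Set ℕ)} (hP : IsPartition P) {a b : ℕ} (ha : sameBlock P a a)
    (hb : sameBlock P b b) : rep P a = rep P b ↔ sameBlock P a b := by
  constructor
  · intro h
    have h1 := sameBlock_rep ha
    rw [h] at h1
    exact sameBlock_trans hP h1 (sameBlock_symm (sameBlock_rep hb))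
  · intro h
    unfold rep
    congr 1
    ext c
    exact ⟨sameBlock_trans hP (sameBlock_symm h), sameBlock_trans hP h⟩

lemma InfPart.rep_eq_iff {P : Set (Set ℕ)} (hP : InfPart P) {a b : ℕ} :
    rep P a = rep P b ↔ sameBlock P a b :=
  DualRamsey.rep_eq_iff hP.1 (hP.refl a) (hP.refl b)

lemma InfPart.rep_le_self {P : Set (Set ℕ)} (hP : InfPart P) (a : ℕ) : rep P a ≤ a :=
  rep_le (hP.refl a)

lemma InfPart.rep_rep {P : Set (Set ℕ)} (hP : InfPart P) (a : ℕ) : rep P (rep P a) = rep P a :=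
  hP.rep_eq_iff.2 (sameBlock_symm (sameBlock_rep (hP.refl a)))

open Relation in
lemma pmeet_spec {P Q : Set (Set ℕ)} (hP : pdom P = Set.univ) :
    IsPartition (pmeet P Q) ∧ pdom (pmeet P Q) = Set.univ ∧ ∀ a b, sameBlock (pmeet P Q) a b ↔
      EqvGen (fun u v => sameBlock P u v ∨ sameBlock Q u v) a b := by
  refine ⟨⟨?_, ?_⟩, ?_, ?_⟩
  · rintro _ ⟨a, -, rfl⟩
    exact ⟨a, EqvGen.refl a⟩
  · rintro _ ⟨a, -, rfl⟩ _ ⟨b, -, rfl⟩ hne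
    rw [Set.disjoint_left]
    intro c hac hbc
    refine hne (Set.ext fun d => ⟨fun h => ?_, fun h => ?_⟩)
    · exact (EqvGen.trans _ _ _ hbc (EqvGen.symm _ _ hac)).trans _ _ _ h
    · exact (EqvGen.trans _ _ _ hac (EqvGen.symm _ _ hbc)).trans _ _ _ h
  · refine Set.eq_univ_of_forall fun a => ⟨_, ⟨a, ?_, rfl⟩, EqvGen.refl a⟩
    simp [hP]
  · intro a b
    constructor
    · rintro ⟨_, ⟨c, -, rfl⟩, ha, hb⟩
      exact EqvGen.trans _ _ _ (EqvGen.symm _ _ ha) hb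
    · intro h
      exact ⟨_, ⟨a, by simp [hP], rfl⟩, EqvGen.refl a, h⟩

/-- An ultrafilter is closed under merging finitely many blocks of its members. -/
lemma IsPUltrafilter.mem_of_finite_merge {F : Set (Set (Set ℕ))} (hF : IsPUltrafilter F)
    {X Y : Set (Set ℕ)} (hX : X ∈ F) (hY : InfPart Y) (N : ℕ)
    (h : ∀ a b, sameBlock Y a b → sameBlock X a b ∨
      ((∃ c < N, sameBlock X a c) ∧ ∃ c < N, sameBlock X b c)) : Y ∈ F := by
  set G : Set (Set (Set ℕ)) := {W | InfPart W ∧ ∃ V ∈ F, ∃ N : ℕ, ∀ a b, sameBlock W a b →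
    sameBlock V a b ∨ ((∃ c < N, sameBlock V a c) ∧ ∃ c < N, sameBlock V b c)} with hG
  have hmeet : ∀ W₁ ∈ G, ∀ W₂ ∈ G, pmeet W₁ W₂ ∈ G := by
    rintro W₁ ⟨hW₁, V₁, hV₁, N₁, h₁⟩ W₂ ⟨hW₂, V₂, hV₂, N₂, h₂⟩
    have hV : InfPart (pmeet V₁ V₂) := hF.1.meet_infPart _ hV₁ _ hV₂
    obtain ⟨hp, hd, hm⟩ := pmeet_spec (P := W₁) (Q := W₂) hW₁.2.1
    obtain ⟨-, -, hmV⟩ :=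
      pmeet_spec (P := V₁) (Q := V₂) (hF.1.mem_infPart _ hV₁).2.1
    have hl : ∀ a b, sameBlock V₁ a b → sameBlock (pmeet V₁ V₂) a b := fun a b hab =>
      (hmV a b).2 (Relation.EqvGen.rel _ _ (Or.inl hab))
    have hr : ∀ a b, sameBlock V₂ a b → sameBlock (pmeet V₁ V₂) a b := fun a b hab =>
      (hmV a b).2 (Relation.EqvGen.rel _ _ (Or.inr hab))
    have key : ∀ a b, sameBlock (pmeet W₁ W₂) a b → sameBlock (pmeet V₁ V₂) a b ∨
        ((∃ c < max N₁ N₂, sameBlock (pmeet V₁ V₂) a c) ∧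
          ∃ c < max N₁ N₂, sameBlock (pmeet V₁ V₂) b c) := by
      intro a b hab
      rw [hm] at hab
      induction hab with
      | rel a b hab =>
        rcases hab with hab | hab
        · rcases h₁ a b hab with h | ⟨⟨c, hc, hac⟩, d, hd, hbd⟩
          · exact Or.inl (hl _ _ h)
          · exact Or.inr ⟨⟨c, lt_max_of_lt_left hc, hl _ _ hac⟩, d, lt_max_of_lt_left hd,
              hl _ _ hbd⟩
        · rcases h₂ a b hab with h | ⟨⟨c, hc, hac⟩, d, hd, hbd⟩
          · exact Or.inl (hr _ _ h)
          · exact Or.inr ⟨⟨c, lt_max_of_lt_right hc, hr _ _ hac⟩, d, lt_max_of_lt_right hd,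
              hr _ _ hbd⟩
      | refl a => exact Or.inl (hV.refl a)
      | symm a b _ ih =>
        rcases ih with h | h
        · exact Or.inl (sameBlock_symm h)
        · exact Or.inr ⟨h.2, h.1⟩
      | trans a b c _ _ ih₁ ih₂ =>
        rcases ih₁ with h | h <;> rcases ih₂ with h' | h'
        · exact Or.inl (sameBlock_trans hV.1 h h')
        · obtain ⟨⟨e, he, hbe⟩, h'⟩ := h'
          exact Or.inr ⟨⟨e, he, sameBlock_trans hV.1 h hbe⟩, h'⟩
        · obtain ⟨h, e, he, hbe⟩ := h
          exact Or.inr ⟨h, e, he, sameBlock_trans hV.1 (sameBlock_symm h') hbe⟩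
        · exact Or.inr ⟨h.1, h'.2⟩
    refine ⟨infPart_iff.2 ⟨hp, hd, fun M => ?_⟩, _, hF.1.meet_mem _ hV₁ _ hV₂, _, key⟩
    obtain ⟨a, ha⟩ := hV.exists_new (max M (max N₁ N₂))
    refine ⟨a, fun c hc hac => ?_⟩
    rcases key a c hac with h | ⟨⟨e, he, hae⟩, -⟩
    · exact ha c (lt_max_of_lt_left hc) h
    · exact ha e (lt_max_of_lt_right he) hae
  have hGfilter : IsPFilter G :=
    { mem_infPart := fun W hW => hW.1
      empty_not_mem := fun h => h.1.2.2 Set.finite_empty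
      upward := by
        rintro W ⟨hW, V, hV, N, hWV⟩ W' hW' hc
        rw [coarser_inf hW hW'] at hc
        exact ⟨hW', V, hV, N, fun a b hab => hWV a b (hc a b hab)⟩
      meet_infPart := fun W₁ h₁ W₂ h₂ => (hmeet W₁ h₁ W₂ h₂).1
      meet_mem := hmeet }
  have hFG : F ⊆ G := fun V hV => ⟨hF.1.mem_infPart V hV, V, hV, 0, fun a b hab => Or.inl hab⟩
  rw [hF.2 G hGfilter hFG]
  exact ⟨hY, X, hX, N, h⟩

/-- Merging the blocks of a member of `F` according to a finite partition stays in `F`. -/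
lemma exists_glue {F : Set (Set (Set ℕ))} (hF : IsPUltrafilter F) {X t : Set (Set ℕ)}
    (hX : X ∈ F) (ht : FinPart t) (htX : Coarser t X) : ∃ Y ∈ F, Y ∈ EllNbhd t X := by
  have hXi := hF.1.mem_infPart X hX
  rw [coarser_fin_inf ht hXi] at htX
  set N := finBound t
  set f : ℕ → ℕ := fun a => if rep X a < N then rep t (rep X a) else rep X a with hf
  have hrt : ∀ a < N, rep t a ≤ a ∧ rep t a < N := fun a ha =>
    ⟨rep_le (ht.refl ha), (rep_le (ht.refl ha)).trans_lt ha⟩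
  have hinf : InfPart (ofFun f Set.univ) := by
    refine infPart_ofFun fun M => ?_
    obtain ⟨a, ha⟩ := hXi.exists_new (max M N)
    refine ⟨a, fun c hc hac => ?_⟩
    have h1 : ¬ rep X a < N := fun h =>
      ha _ (lt_max_of_lt_right h) (sameBlock_rep (hXi.refl a))
    simp only [hf, h1, if_false] at hac
    split_ifs at hac with h2
    · exact h1 (hac ▸ (hrt _ h2).2)
    · exact ha c (lt_max_of_lt_left hc) (hXi.rep_eq_iff.1 hac)
  have hlt : ∀ a, rep X a < N → ∃ c < N, sameBlock X a c := fun a h =>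
    ⟨_, h, sameBlock_rep (hXi.refl a)⟩
  refine ⟨ofFun f Set.univ, ?_, hinf, ?_, ?_⟩
  · refine hF.mem_of_finite_merge hX hinf N fun a b hab => ?_
    have hab := (sameBlock_ofFun.1 hab).2.2
    simp only [hf] at hab
    split_ifs at hab with h1 h2 h2
    · exact Or.inr ⟨hlt a h1, hlt b h2⟩
    · exact absurd (hab ▸ (hrt _ h1).2) h2
    · exact absurd (hab ▸ (hrt _ h2).2) h1
    · exact Or.inl (hXi.rep_eq_iff.1 hab)
  · rw [segment_inf ht hinf]
    have hft : ∀ a < N, f a = rep t a := by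
      intro a ha
      have h1 : rep X a < N := (hXi.rep_le_self a).trans_lt ha
      simp only [hf, h1, if_true]
      rw [rep_eq_iff ht.1 (ht.refl h1) (ht.refl ha)]
      exact htX _ h1 _ ha (sameBlock_symm (sameBlock_rep (hXi.refl a)))
    intro a ha b hb
    rw [sameBlock_ofFun, hft a ha, hft b hb, rep_eq_iff ht.1 (ht.refl ha) (ht.refl hb)]
    simp
  · rw [coarser_inf hinf hXi]
    intro a b hab
    rw [sameBlock_ofFun]
    simp only [Set.mem_univ, true_and, hf, hXi.rep_eq_iff.2 hab]

/-- The initial segment of `X` ending where the first block disjoint from `dom b` begins. -/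
lemma exists_cut {b X : Set (Set ℕ)} (hb : FinPart b) (hX : InfPart X) (hbX : Segment b X) :
    ∃ t, FinPart t ∧ Segment b t ∧ t.ncard = b.ncard ∧ Segment (sStar t) X := by
  classical
  have hex := hX.exists_new (finBound b)
  set N := Nat.find hex
  have hN : ∀ c < finBound b, ¬ sameBlock X N c := Nat.find_spec hex
  have hmin : ∀ a < N, ∃ c < finBound b, sameBlock X a c := fun a ha => by
    have := Nat.find_min hex ha
    push Not at this
    exact this
  have hbN : finBound b ≤ N := not_lt.1 fun h => hN N h (hX.refl N)
  have ht := finPart_ofFun (rep X) N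
  have htX : ∀ a b, sameBlock (ofFun (rep X) (Set.Iio N)) a b ↔ a < N ∧ b < N ∧ sameBlock X a b :=
    fun a b => by rw [sameBlock_ofFun, hX.rep_eq_iff]; rfl
  have hbt : Segment b (ofFun (rep X) (Set.Iio N)) := by
    rw [segment_inf hb hX] at hbX
    rw [segment_fin hb ht, finBound_ofFun]
    refine ⟨hbN, fun a ha c hc => ?_⟩
    rw [hbX a ha c hc, htX]
    exact ⟨fun h => ⟨ha.trans_le hbN, hc.trans_le hbN, h⟩, fun h => h.2.2⟩
  refine ⟨_, ht, hbt, ?_, ?_⟩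
  · rw [ncard_eq_iff hb ht hbt, finBound_ofFun]
    intro a ha
    obtain ⟨c, hc, hac⟩ := hmin a ha
    exact ⟨c, hc, (htX a c).2 ⟨ha, hc.trans_le hbN, hac⟩⟩
  · have hNnew : ∀ a < N, ¬ sameBlock X N a := fun a ha hNa => by
      obtain ⟨c, hc, hac⟩ := hmin a ha
      exact hN c hc (sameBlock_trans hX.1 hNa hac)
    rw [segment_inf (finPart_sStar ht) hX, finBound_sStar ht, finBound_ofFun]
    intro a ha c hc
    rw [sameBlock_sStar, finBound_ofFun, htX]
    have hsymm : sameBlock X a c → sameBlock X c a := sameBlock_symm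
    have hrefl := hX.refl N
    grind

/-- If `Y` coarsens `X` and extends `t`, then some member of `F` between them extends `t₀` and
has the same coarsenings extending `t` as `Y`. -/
lemma exists_unglue {F : Set (Set (Set ℕ))} (hF : IsPFilter F) {X Y t₀ t : Set (Set ℕ)}
    (hX : X ∈ F) (hY : Y ∈ F) (hYX : Coarser Y X) (ht₀ : FinPart t₀) (ht : FinPart t)
    (hdom : pdom t = pdom t₀) (ht₀X : Segment t₀ X) (htY : Segment t Y) :
    ∃ W ∈ F, W ∈ EllNbhd t₀ X ∧
      ∀ u, FinPart u → Segment t u → Coarser (sStar u) W → Coarser (sStar u) Y := by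
  have hXi := hF.mem_infPart X hX
  have hYi := hF.mem_infPart Y hY
  rw [coarser_inf hYi hXi] at hYX
  set N := finBound t₀
  have htN : finBound t = N := finBound_eq (hdom.trans ht₀.pdom_eq)
  rw [segment_inf ht hYi, htN] at htY
  rw [segment_inf ht₀ hXi] at ht₀X
  set f : ℕ → ℕ := fun a => if rep X a < N then rep X a else rep Y a with hf
  have hfY : ∀ a, sameBlock Y a (f a) := by
    intro a
    simp only [hf]
    split_ifs
    · exact hYX _ _ (sameBlock_rep (hXi.refl a))
    · exact sameBlock_rep (hYi.refl a)
  have hfle : ∀ a, f a ≤ a := by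
    intro a
    simp only [hf]
    split_ifs
    · exact hXi.rep_le_self a
    · exact hYi.rep_le_self a
  have hWY : ∀ a b, f a = f b → sameBlock Y a b := fun a b hab =>
    sameBlock_trans hYi.1 (hfY a) (hab ▸ sameBlock_symm (hfY b))
  have hinf : InfPart (ofFun f Set.univ) := by
    refine infPart_ofFun fun M => ?_
    obtain ⟨a, ha⟩ := hYi.exists_new M
    exact ⟨a, fun c hc hac => ha c hc (hWY a c hac)⟩
  have hfsmall : ∀ a < N, f a = rep X a := fun a ha =>
    if_pos ((hXi.rep_le_self a).trans_lt ha)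
  have hff : ∀ a, f a < N → f (f a) = f a := by
    intro a ha
    rw [hfsmall _ ha]
    simp only [hf] at ha ⊢
    split_ifs at ha ⊢
    · exact hXi.rep_rep a
    · have h1 := sameBlock_trans hYi.1 (sameBlock_rep (hYi.refl a))
        (hYX _ _ (sameBlock_rep (hXi.refl (rep Y a))))
      exact (hXi.rep_le_self _).antisymm (rep_le h1)
  refine ⟨ofFun f Set.univ, ?_, ⟨hinf, ?_, ?_⟩, ?_⟩
  · refine hF.upward Y hY _ hinf ((coarser_inf hYi hinf).2 fun a b hab => ?_)
    exact hWY a b (sameBlock_ofFun.1 hab).2.2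
  · rw [segment_inf ht₀ hinf]
    intro a ha b hb
    rw [sameBlock_ofFun, hfsmall a ha, hfsmall b hb, hXi.rep_eq_iff, ht₀X a ha b hb]
    simp
  · rw [coarser_inf hinf hXi]
    intro a b hab
    rw [sameBlock_ofFun]
    simp only [Set.mem_univ, true_and, hf, hXi.rep_eq_iff.2 hab, hYi.rep_eq_iff.2 (hYX _ _ hab)]
  · intro u hu htu huW
    have hus := finPart_sStar hu
    rw [coarser_fin_inf hus hinf] at huW
    rw [segment_fin ht hu, htN] at htu
    rw [coarser_fin_inf hus hYi]
    intro a ha b hb hab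
    have hW : ∀ a < finBound (sStar u), f a < N → sameBlock (sStar u) a (f a) := fun a ha haN =>
      huW a ha _ ((hfle a).trans_lt ha) (sameBlock_ofFun.2 ⟨trivial, trivial, (hff a haN).symm⟩)
    by_cases heq : f a = f b
    · exact huW a ha b hb (sameBlock_ofFun.2 ⟨trivial, trivial, heq⟩)
    have hsm : f a < N ∧ f b < N := by
      have hrY := hYi.rep_eq_iff.2 hab
      have hle : ∀ c, rep Y c ≤ rep X c := fun c =>
        rep_le (hYX _ _ (sameBlock_rep (hXi.refl c)))
      have h1 := hle a
      have h2 := hle b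
      simp only [hf] at heq ⊢
      split_ifs at heq ⊢ <;> omega
    have hu' : sameBlock u (f a) (f b) := by
      rw [← htu.2 _ hsm.1 _ hsm.2, htY _ hsm.1 _ hsm.2]
      exact sameBlock_trans hYi.1 (sameBlock_symm (hfY a)) (sameBlock_trans hYi.1 hab (hfY b))
    exact sameBlock_trans hus.1 (hW a ha hsm.1)
      (sameBlock_trans hus.1 (sameBlock_sStar.2 (Or.inl hu')) (sameBlock_symm (hW b hb hsm.2)))

/-- Substitute the letter `a` for the variable `none` in a variable word. -/
def subst {α : Type} (v : List (Option α)) (a : α) : List α := v.map (·.getD a)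

/-- For every finite colouring of words there are `r` and `m` left-variable words such that the
colour of `r` followed by instances of the first `i` of them depends only on `i`. -/
lemma exists_uniform_words {α : Type} [Finite α] (m : ℕ) :
    ∀ (κ : Type) [Finite κ] (C : List α → κ), ∃ (r : List α) (vs : List (List (Option α)))
      (c : ℕ → κ), vs.length = m ∧ ∀ as : List α, as.length ≤ m →
        C (r ++ (List.zipWith (fun v a => a :: subst v a) vs as).flatten) = c as.length := by
  induction m with
  | zero =>
    intro κ _ C
    refine ⟨[], [], fun _ => C [], rfl, fun as has => by simp⟩
  | succ m ih =>
    intro κ _ C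
    obtain ⟨ι, _, hι⟩ :=
      Combinatorics.Line.exists_mono_in_high_dimension α (Fin (m + 1) → κ)
    let e := Fintype.equivFin ι
    obtain ⟨r, vs, c, hlen, hc⟩ :=
      ih ((ι → α) → κ) fun w q => C (List.ofFn (fun i => q (e.symm i)) ++ w)
    obtain ⟨l, χ, hχ⟩ := hι fun q i => c i q
    have hmem : none ∈ List.ofFn fun i => l.idxFun (e.symm i) := by
      obtain ⟨i, hi⟩ := l.proper
      rw [List.mem_ofFn]
      exact ⟨e i, by simpa using hi⟩
    obtain ⟨d, v, hdv, hd⟩ := List.eq_append_cons_of_mem hmem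
    obtain ⟨d, rfl⟩ : ∃ d' : List α, d = d'.map some := by
      refine ⟨d.filterMap id, ?_⟩
      rw [List.map_filterMap]
      conv_lhs => rw [← List.filterMap_some (l := d)]
      refine List.filterMap_congr fun x hx => ?_
      rcases x with _ | x
      · exact absurd hx hd
      · rfl
    have hline : ∀ a, List.ofFn (fun i => l a (e.symm i)) = d ++ a :: subst v a := by
      intro a
      have := congrArg (fun w => subst w a) hdv
      simpa [subst, List.map_ofFn, Function.comp_def, Combinatorics.Line.apply_def] using this
    refine ⟨d, (v ++ r.map some) :: vs, fun i => if h : 0 < i ∧ i ≤ m + 1 then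
      χ ⟨i - 1, by omega⟩ else C d, by simp [hlen], ?_⟩
    rintro (_ | ⟨a, as⟩) has
    · simp
    · simp only [List.length_cons] at has
      have h1 := congrFun (hc as (by omega)) (l a)
      have h2 := congrFun (hχ a) ⟨as.length, by omega⟩
      simp only at h1 h2
      rw [hline] at h1
      simp only [List.length_cons]
      rw [dif_pos (by omega)]
      simp only [Nat.add_sub_cancel]
      rw [← h2, ← h1]
      simp [subst, Function.comp_def]

/-- For every finite colouring of words there is a word `r` and a left-variable word all of whose
instances, prefixed by `r`, have the colour of `r`. -/
lemma exists_left_line {α κ : Type} [Finite α] [Finite κ] (a₀ : α) (C : List α → κ) :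
    ∃ (r : List α) (w : List (Option α)), ∀ a, C (r ++ a :: subst w a) = C r := by
  obtain ⟨m, ⟨e⟩⟩ := Finite.exists_equiv_fin κ
  obtain ⟨r, vs, c, hlen, hc⟩ := exists_uniform_words (α := α) m κ C
  obtain ⟨i, j, hij, hcij⟩ : ∃ i j : Fin (m + 1), i < j ∧ c i = c j := by
    obtain ⟨i, j, hne, h⟩ := Fintype.exists_ne_map_eq_of_card_lt
      (fun i : Fin (m + 1) => e (c i)) (by simp)
    rcases lt_or_gt_of_ne hne with h' | h'
    · exact ⟨i, j, h', e.injective h⟩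
    · exact ⟨j, i, h', (e.injective h).symm⟩
  have hi : (i : ℕ) < j := hij
  have hjm : (j : ℕ) ≤ m := Nat.lt_succ_iff.1 j.2
  set r' := r ++ (List.zipWith (fun v a => a :: subst v a) vs (List.replicate i a₀)).flatten
  have hr' : C r' = c i := by
    have := hc (List.replicate i a₀) (by simp; omega)
    rwa [List.length_replicate] at this
  have hdrop : ∃ v us, (vs.take j).drop i = v :: us :=
    List.exists_cons_of_length_pos (by simp [hlen]; omega)
  obtain ⟨v, us, hvus⟩ := hdrop
  refine ⟨r', v ++ (us.map (none :: ·)).flatten, fun a => ?_⟩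
  have h2 := hc (List.replicate i a₀ ++ List.replicate (j - i) a) (by simp; omega)
  have hsub : ∀ (xs : List (List (Option α))) (n : ℕ), xs.length ≤ n →
      (List.zipWith (fun v a => a :: subst v a) xs (List.replicate n a)).flatten =
        subst ((xs.map (none :: ·)).flatten) a := by
    intro xs
    induction xs with
    | nil => intro n _; simp [subst]
    | cons x xs ih =>
      rintro (_ | n) hn
      · simp at hn
      · simp only [List.length_cons] at hn
        have := ih n (by omega)
        simp only [subst] at this ⊢
        simp [List.replicate_succ, this]
  have hvs : vs = vs.take i ++ ((v :: us) ++ vs.drop j) := by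
    rw [← hvus, List.drop_take]
    conv_lhs => rw [← List.take_append_drop i vs, ← List.take_append_drop (j - i) (vs.drop i)]
    rw [List.drop_drop, show (i : ℕ) + (j - i) = j by omega]
  have hlen₁ : (vs.take i).length = (List.replicate (i : ℕ) a₀).length := by
    simp [hlen]; omega
  have hlen₂ : (v :: us).length = (List.replicate ((j : ℕ) - i) a).length := by
    rw [← hvus]; simp [hlen]; omega
  have hr'' : r' = r ++ (List.zipWith (fun v a => a :: subst v a) (vs.take i)
      (List.replicate i a₀)).flatten := by
    have := List.zipWith_append (f := fun (v : List (Option α)) a => a :: subst v a)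
      (l₁' := (v :: us) ++ vs.drop j) (l₂' := []) hlen₁
    rw [← hvs, List.append_nil, List.zipWith_nil_right, List.append_nil] at this
    rw [← this]
  have htail := List.zipWith_append (f := fun (v : List (Option α)) a => a :: subst v a)
    (l₁' := vs.drop j) (l₂' := []) hlen₂
  rw [List.append_nil, List.zipWith_nil_right, List.append_nil] at htail
  rw [hvs, List.zipWith_append hlen₁, htail, List.flatten_append, ← List.append_assoc, ← hr'',
    hsub _ _ (by rw [hlen₂, List.length_replicate])] at h2
  have hlen₃ : (List.replicate (i : ℕ) a₀ ++ List.replicate ((j : ℕ) - i) a).length = j := by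
    simp; omega
  rw [hlen₃, ← hcij, ← hr'] at h2
  rw [← h2]
  simp [subst]

lemma eq_ofFun_of_forall_exists {s v Z : Set (Set ℕ)} (hs : FinPart s) (hv : FinPart v)
    (hZ : InfPart Z) (hsv : Segment s v) (hsZ : Segment s Z) {f : ℕ → ℕ} {N : ℕ}
    (hN : finBound v = N) (h : ∀ a < N, ∃ c < finBound s, sameBlock v a c ∧ f a = rep Z c) :
    v = ofFun f (Set.Iio N) := by
  subst hN
  rw [segment_fin hs hv] at hsv
  rw [segment_inf hs hZ] at hsZ
  refine eq_of_sameBlock_iff hv.1 (isPartition_ofFun _ _) fun a b => ?_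
  rw [sameBlock_ofFun]
  suffices H : a < finBound v → b < finBound v → (sameBlock v a b ↔ f a = f b) from
    ⟨fun hab => ⟨(hv.lt_of_sameBlock hab).1, (hv.lt_of_sameBlock hab).2,
      (H (hv.lt_of_sameBlock hab).1 (hv.lt_of_sameBlock hab).2).1 hab⟩,
      fun hab => (H hab.1 hab.2.1).2 hab.2.2⟩
  intro ha hb
  obtain ⟨c, hc, hac, hfa⟩ := h a ha
  obtain ⟨d, hd, hbd, hfb⟩ := h b hb
  rw [hfa, hfb, hZ.rep_eq_iff, ← hsZ c hc d hd, hsv.2 c hc d hd]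
  constructor
  · intro hab
    exact sameBlock_trans hv.1 (sameBlock_symm hac) (sameBlock_trans hv.1 hab hbd)
  · intro hcd
    exact sameBlock_trans hv.1 hac (sameBlock_trans hv.1 hcd (sameBlock_symm hbd))

lemma sStar_ofFun_coarser {Z : Set (Set ℕ)} (hZ : InfPart Z) {N : ℕ} (hN : rep Z N = N)
    {f : ℕ → ℕ} (hf : ∀ a b, rep Z a = rep Z b → f a = f b) :
    Coarser (sStar (ofFun f (Set.Iio N))) Z := by
  have ht := finPart_ofFun f N
  rw [coarser_fin_inf (finPart_sStar ht) hZ, finBound_sStar ht, finBound_ofFun]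
  intro a ha b hb hab
  rw [← hZ.rep_eq_iff] at hab
  rw [sameBlock_sStar, finBound_ofFun, sameBlock_ofFun, Set.mem_Iio, Set.mem_Iio]
  have h1 := hf a b hab
  have h2 := hZ.rep_le_self a
  have h3 := hZ.rep_le_self b
  rcases Nat.lt_succ_iff_lt_or_eq.1 ha with ha | rfl <;>
    rcases Nat.lt_succ_iff_lt_or_eq.1 hb with hb | rfl <;> omega

/-- Blocks of `Z` meeting `[0, B)` are moved according to `q`; the remaining ones follow the word
`f`, indexed by `idx`, where `none` stands for the new block of `E`. -/
def wordFun {n B : ℕ} (z idx : ℕ → ℕ) (q : Fin B → Fin n) (f : ℕ → Option (Fin n)) (E : ℕ)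
    (a : ℕ) : ℕ :=
  if h : z a < B then z (q ⟨z a, h⟩) else (f (idx a)).elim E fun c => z c

/-- If every extension of `b` obtained from `Z` by absorbing blocks has a coarsening in `D`, then
`D` contains some `r` and all instances of a left-variable extension of `r`. -/
lemma exists_line_of_hit {s b Z : Set (Set ℕ)} (hs : FinPart s) (hb : FinPart b) (hZ : InfPart Z)
    (hsb : Segment s b) (hbZ : Segment b Z) (hpos : 0 < finBound s)
    {D : Set (Set (Set ℕ))} (hD : D ⊆ nsegOmega s s.ncard)
    (hhit : ∀ u, FinPart u → Segment b u → Coarser (sStar u) Z → u.ncard = b.ncard →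
      (iseg0 s u ∩ D).Nonempty) :
    ∃ r ∈ D, ∃ u, FinPart u ∧ Segment (sStar r) u ∧ Segment s u ∧ Coarser (sStar u) Z ∧
      u.ncard = s.ncard + 1 ∧ iseg0 s u ⊆ D := by
  classical
  have hsb' := (segment_fin hs hb).1 hsb
  have hbZ' := (segment_inf hb hZ).1 hbZ
  set n := finBound s
  set B := finBound b
  have hnB : n ≤ B := hsb'.1
  have hsZ' : ∀ a < n, ∀ c < n, (sameBlock s a c ↔ sameBlock Z a c) := fun a ha c hc =>
    (hsb'.2 a ha c hc).trans (hbZ' a (ha.trans_le hnB) c (hc.trans_le hnB))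
  have hsZ : Segment s Z := (segment_inf hs hZ).2 hsZ'
  set z := rep Z
  have hzle : ∀ a, z a ≤ a := hZ.rep_le_self
  have hzz : ∀ a, z (z a) = z a := hZ.rep_rep
  set P : ℕ → Prop := fun m => z m = m ∧ B ≤ m
  have hPinf : {m | P m}.Infinite := by
    refine Set.infinite_of_not_bddAbove fun ⟨M, hM⟩ => ?_
    obtain ⟨a, ha⟩ := hZ.exists_new (max B (M + 1))
    have h1 : max B (M + 1) ≤ z a := not_lt.1 fun h => ha _ h (sameBlock_rep (hZ.refl a))
    have h2 : z a ≤ M := hM ⟨hzz a, (le_max_left _ _).trans h1⟩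
    have := (le_max_right B (M + 1)).trans h1
    omega
  set e := Nat.nth P
  set idx : ℕ → ℕ := fun a => Nat.count P (z a)
  have he : ∀ i, z (e i) = e i ∧ B ≤ e i := fun i => Nat.nth_mem_of_infinite hPinf i
  have hemono : StrictMono e := Nat.nth_strictMono hPinf
  have hidxe : ∀ i, idx (e i) = i := fun i => by
    simp only [idx, (he i).1]
    exact Nat.count_nth_of_infinite hPinf i
  have heidx : ∀ a, B ≤ z a → e (idx a) = z a := fun a ha => Nat.nth_count ⟨hzz a, ha⟩
  have hidxlt : ∀ a h, a < e h → B ≤ z a → idx a < h := fun a h ha hB => by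
    rw [← hemono.lt_iff_lt, heidx a hB]
    exact (hzle a).trans_lt ha
  have hidxz : ∀ a c, z a = z c → idx a = idx c := fun a c h => by simp only [idx, h]
  have hcol : ∀ w : List (Fin n), ∃ q : Fin B → Fin n,
      (∀ c : Fin B, (c : ℕ) < n → z (q c) = z c) ∧
        ofFun (wordFun z idx q (w[·]?) 0) (Set.Iio (e w.length)) ∈ D := by
    intro w
    set g : ℕ → ℕ := fun a => if z a < B then z a else (w[idx a]?).elim 0 fun c => z c with hg
    have hgsmall : ∀ a < B, g a = z a := fun a ha => if_pos ((hzle a).trans_lt ha)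
    have hu := finPart_ofFun g (e w.length)
    have hBe := (he w.length).2
    have hbu : Segment b (ofFun g (Set.Iio (e w.length))) := by
      rw [segment_fin hb hu, finBound_ofFun]
      refine ⟨hBe, fun a ha c hc => ?_⟩
      rw [sameBlock_ofFun, hgsmall a ha, hgsmall c hc, hZ.rep_eq_iff, hbZ' a ha c hc]
      exact ⟨fun h => ⟨ha.trans_le hBe, hc.trans_le hBe, h⟩, fun h => h.2.2⟩
    have hgrep : ∀ a < e w.length, B ≤ z a → ∃ c : Fin n, w[idx a]? = some c ∧ g a = g c := by
      intro a ha hB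
      have := hidxlt a _ ha hB
      refine ⟨w[idx a], by simp [this], ?_⟩
      rw [hgsmall _ ((w[idx a]).2.trans_le hnB)]
      simp [hg, not_lt.2 hB, this]
    obtain ⟨v, ⟨hv, hdom, hsv, hvu, hcard⟩, hvD⟩ := hhit _ hu hbu
      (sStar_ofFun_coarser hZ (he _).1 fun a c hac => by
        simp only [hg, show z a = z c from hac, hidxz a c hac])
      (by
        rw [ncard_eq_iff hb hu hbu, finBound_ofFun]
        intro a ha
        by_cases hB : z a < B
        · refine ⟨z a, hB, sameBlock_ofFun.2 ⟨ha, hB.trans_le hBe, ?_⟩⟩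
          rw [hgsmall _ hB, hzz]
          exact if_pos hB
        · obtain ⟨c, -, hc⟩ := hgrep a ha (not_lt.1 hB)
          have hcB := c.2.trans_le hnB
          exact ⟨c, hcB, sameBlock_ofFun.2 ⟨ha, hcB.trans_le hBe, hc⟩⟩)
    have hfbv : finBound v = e w.length := finBound_eq (hdom.trans (pdom_ofFun _ _))
    rw [coarser_fin hv hu hdom] at hvu
    rw [ncard_eq_iff hs hv hsv, hfbv] at hcard
    choose! p hpn hp using hcard
    refine ⟨fun c => ⟨p c, hpn c (c.2.trans_le hBe)⟩, fun c hc => ?_, ?_⟩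
    · have h1 := hp c (c.2.trans_le hBe)
      have h2 := hpn c (c.2.trans_le hBe)
      rw [← ((segment_fin hs hv).1 hsv).2 c hc _ h2, hsZ' _ hc _ h2] at h1
      exact (hZ.rep_eq_iff.2 h1).symm
    · convert! hvD using 1
      refine (eq_ofFun_of_forall_exists hs hv hZ hsv hsZ hfbv fun a ha => ?_).symm
      by_cases hB : z a < B
      · have hBe' := hB.trans_le hBe
        refine ⟨p (z a), hpn _ hBe', ?_, by simp [wordFun, hB, z]⟩
        refine sameBlock_trans hv.1 (hvu _ _ (sameBlock_ofFun.2 ⟨ha, hBe', ?_⟩)) (hp _ hBe')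
        rw [hgsmall _ hB, hzz]
        exact if_pos hB
      · obtain ⟨c, hwc, hc⟩ := hgrep a ha (not_lt.1 hB)
        have hcB := c.2.trans_le hnB
        exact ⟨c, c.2, hvu _ _ (sameBlock_ofFun.2 ⟨ha, hcB.trans_le hBe, hc⟩),
          by simp [wordFun, hB, hwc, z]⟩
  choose C hCn hCD using hcol
  obtain ⟨r, w, hrw⟩ := exists_left_line (⟨0, hpos⟩ : Fin n) C
  set q := C r
  set W : List (Option (Fin n)) := r.map some ++ none :: w with hW
  have hsubW : ∀ c, subst W c = r ++ c :: subst w c := fun c => by simp [hW, subst]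
  set E := e r.length
  set G := wordFun z idx q (fun i => (W[i]?).join) E with hG
  have hBE : B ≤ E := (he _).2
  have hrW : r.length < W.length := by simp [hW]
  have hEW : E < e W.length := hemono hrW
  have hGn : ∀ c < n, G c = z c := by
    intro c hc
    have hzn := (hzle c).trans_lt hc
    have hzB := hzn.trans_le hnB
    simp only [hG, wordFun, hzB, dif_pos]
    rw [hCn r ⟨z c, hzB⟩ hzn]
    exact hzz c
  have hGE : G E = E := by
    simp [hG, wordFun, (he r.length).1, not_lt.2 hBE, hidxe, E, hW]
  have hGcongr : ∀ a c, z a = z c → G a = G c := fun a c h => by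
    simp only [hG, wordFun, h, hidxz a c h]
  have hGr : ∀ a < E, wordFun z idx q (r[·]?) 0 a = G a ∧ ∃ c < n, G a = z c := by
    intro a ha
    by_cases hB : z a < B
    · simp only [hG, wordFun, hB, dif_pos, true_and]
      exact ⟨_, (q ⟨z a, hB⟩).2, rfl⟩
    · have hlt := hidxlt a _ ha (not_lt.1 hB)
      simp only [hG, wordFun, hB, dif_neg, not_false_iff, hW]
      rw [List.getElem?_append_left (by simpa using hlt)]
      simp [hlt]
      exact ⟨_, (r[idx a]).2, rfl⟩
  have hu := finPart_ofFun G (e W.length)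
  have hr := finPart_ofFun (wordFun z idx q (r[·]?) 0) E
  have hru : Segment (sStar (ofFun (wordFun z idx q (r[·]?) 0) (Set.Iio E)))
      (ofFun G (Set.Iio (e W.length))) := by
    rw [segment_fin (finPart_sStar hr) hu, finBound_sStar hr, finBound_ofFun, finBound_ofFun]
    refine ⟨hEW, fun a ha c hc => ?_⟩
    rw [sameBlock_sStar, finBound_ofFun, sameBlock_ofFun, sameBlock_ofFun]
    simp only [Set.mem_Iio]
    have hne : ∀ a < E, G a ≠ E := by
      intro a ha h
      obtain ⟨c, hc, hac⟩ := (hGr a ha).2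
      have := hzle c
      omega
    rcases Nat.lt_succ_iff_lt_or_eq.1 ha with ha | rfl <;>
      rcases Nat.lt_succ_iff_lt_or_eq.1 hc with hc | rfl
    · rw [(hGr a ha).1, (hGr c hc).1]
      simp [ha, hc, ha.ne, ha.trans hEW, hc.trans hEW]
    · simp [hGE, hne a ha, ha.ne]
    · simp [hGE, (hne c hc).symm, hc.ne]
    · simp [hEW]
  refine ⟨_, hCD r, _, hu, hru, ?_, sStar_ofFun_coarser hZ (he _).1 hGcongr, ?_, ?_⟩
  · rw [segment_fin hs hu, finBound_ofFun]
    have hne : n ≤ e W.length := by omega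
    refine ⟨hne, fun a ha c hc => ?_⟩
    rw [sameBlock_ofFun, hGn a ha, hGn c hc, hZ.rep_eq_iff, hsZ' a ha c hc]
    exact ⟨fun h => ⟨ha.trans_le hne, hc.trans_le hne, h⟩, fun h => h.2.2⟩
  · rw [← (hD (hCD r)).2.1, ← ncard_sStar hr, ncard_eq_iff (finPart_sStar hr) hu hru,
      finBound_sStar hr, finBound_ofFun, finBound_ofFun]
    intro a ha
    have hGa : G a = E ∨ ∃ c < n, G a = z c := by
      by_cases hB : z a < B
      · simp only [hG, wordFun, hB, dif_pos]
        exact Or.inr ⟨_, (q ⟨z a, hB⟩).2, rfl⟩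
      · simp only [hG, wordFun, hB, dif_neg, not_false_iff]
        rcases (W[idx a]?).join with _ | c
        · exact Or.inl rfl
        · exact Or.inr ⟨c, c.2, rfl⟩
    rcases hGa with h | ⟨c, hc, h⟩
    · exact ⟨E, Nat.lt_succ_self E, sameBlock_ofFun.2 ⟨ha, hEW, h.trans hGE.symm⟩⟩
    · refine ⟨c, by omega, sameBlock_ofFun.2 ⟨ha, ?_, h.trans (hGn c hc).symm⟩⟩
      simp only [Set.mem_Iio]
      omega
  · rintro v ⟨hv, hdom, hsv, hvu, hcard⟩
    have hfbv : finBound v = e W.length := finBound_eq (hdom.trans (pdom_ofFun _ _))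
    rw [coarser_fin hv hu hdom] at hvu
    rw [ncard_eq_iff hs hv hsv, hfbv] at hcard
    obtain ⟨c, hc, hEc⟩ := hcard E hEW
    have hlen : (subst W ⟨c, hc⟩).length = W.length := by simp [subst]
    have hmem := hCD (subst W ⟨c, hc⟩)
    have hCq : C (subst W ⟨c, hc⟩) = q := by rw [hsubW, hrw]
    rw [hlen, hCq] at hmem
    convert! hmem using 1
    refine eq_ofFun_of_forall_exists hs hv hZ hsv hsZ hfbv fun a ha => ?_
    have hrel : ∀ d < n, G a = z d → sameBlock v a d := fun d hd h => by
      refine hvu _ _ (sameBlock_ofFun.2 ⟨ha, ?_, h.trans (hGn d hd).symm⟩)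
      simp only [Set.mem_Iio]
      omega
    by_cases hB : z a < B
    · refine ⟨q ⟨z a, hB⟩, (q ⟨z a, hB⟩).2, hrel _ (q ⟨z a, hB⟩).2 ?_, ?_⟩
      · simp [hG, wordFun, hB]
      · simp [wordFun, hB, z]
    · have hlt := hidxlt a _ ha (not_lt.1 hB)
      rcases hx : W[idx a] with _ | d
      · refine ⟨c, hc, ?_, ?_⟩
        · refine sameBlock_trans hv.1 (hvu _ _ (sameBlock_ofFun.2 ⟨ha, hEW, ?_⟩)) hEc
          rw [hGE]
          simp [hG, wordFun, hB, hlt, hx]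
        · simp [wordFun, hB, subst, hlt, hx, z]
      · refine ⟨d, d.2, hrel d d.2 ?_, ?_⟩
        · simp [hG, wordFun, hB, hlt, hx]
        · simp [wordFun, hB, subst, hlt, hx, z]

lemma Coarser.trans_inf {Z Y X : Set (Set ℕ)} (hZ : InfPart Z) (hY : InfPart Y) (hX : InfPart X)
    (hZY : Coarser Z Y) (hYX : Coarser Y X) : Coarser Z X := by
  rw [coarser_inf hZ hY] at hZY
  rw [coarser_inf hY hX] at hYX
  exact (coarser_inf hZ hX).2 fun a b hab => hZY a b (hYX a b hab)

lemma Coarser.trans_fin {u Y X : Set (Set ℕ)} (hu : FinPart u) (hY : InfPart Y) (hX : InfPart X)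
    (huY : Coarser u Y) (hYX : Coarser Y X) : Coarser u X := by
  rw [coarser_fin_inf hu hY] at huY
  rw [coarser_inf hY hX] at hYX
  exact (coarser_fin_inf hu hX).2 fun a ha b hb hab => huY a ha b hb (hYX a b hab)

lemma Segment.trans_fin {s t u : Set (Set ℕ)} (hs : FinPart s) (ht : FinPart t) (hu : FinPart u)
    (hst : Segment s t) (htu : Segment t u) : Segment s u := by
  rw [segment_fin hs ht] at hst
  rw [segment_fin ht hu] at htu
  exact (segment_fin hs hu).2 ⟨hst.1.trans htu.1, fun a ha b hb => (hst.2 a ha b hb).trans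
    (htu.2 a (ha.trans_le hst.1) b (hb.trans_le hst.1))⟩

lemma Segment.trans_inf {s t X : Set (Set ℕ)} (hs : FinPart s) (ht : FinPart t) (hX : InfPart X)
    (hst : Segment s t) (htX : Segment t X) : Segment s X := by
  rw [segment_fin hs ht] at hst
  rw [segment_inf ht hX] at htX
  exact (segment_inf hs hX).2 fun a ha b hb => (hst.2 a ha b hb).trans
    (htX a (ha.trans_le hst.1) b (hb.trans_le hst.1))

lemma segment_sStar {t : Set (Set ℕ)} (ht : FinPart t) : Segment t (sStar t) := by
  rw [segment_fin ht (finPart_sStar ht), finBound_sStar ht]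
  refine ⟨Nat.le_succ _, fun a ha b hb => ?_⟩
  rw [sameBlock_sStar]
  exact ⟨Or.inl, fun h => h.resolve_right (by omega)⟩

lemma Segment.coarser {t X : Set (Set ℕ)} (ht : FinPart t) (hX : InfPart X) (htX : Segment t X) :
    Coarser t X := by
  rw [segment_inf ht hX] at htX
  exact (coarser_fin_inf ht hX).2 fun a ha b hb => (htX a ha b hb).2

/-- No left-variable extension `u` of a member of `D` that extends `t` and is compatible with `Y`
has all its instances in `D`. -/
def Killed (D : Set (Set (Set ℕ))) (s t Y : Set (Set ℕ)) : Prop :=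
  ∀ r ∈ D, Segment (sStar r) t → Segment s t → t.ncard = s.ncard + 1 →
    ∀ u, FinPart u → Segment t u → Coarser (sStar u) Y → u.ncard = s.ncard + 1 → ¬ iseg0 s u ⊆ D

lemma Killed.mono {D : Set (Set (Set ℕ))} {s t Y Z : Set (Set ℕ)} (hY : InfPart Y)
    (hZ : InfPart Z) (hZY : Coarser Z Y) (h : Killed D s t Y) : Killed D s t Z :=
  fun r hr hrt hst htn u hu htu huZ =>
    h r hr hrt hst htn u hu htu (huZ.trans_fin (finPart_sStar hu) hZ hY hZY)

/-- No member of `D` has a left-variable extension `t` below `X` for which the extensions of `t`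
with all instances in `D` are `1`-dense. -/
def NoOneDense (F D : Set (Set (Set ℕ))) (s X : Set (Set ℕ)) : Prop :=
  ∀ r ∈ D, ∀ t ∈ nseg s X (s.ncard + 1), Segment (sStar r) t → ∀ Y ∈ EllNbhd t X, Y ∈ F →
    ¬ KDense F {u | FinPart u ∧ Segment t u ∧ iseg0 s u ⊆ D} s t Y 1

lemma exists_killed {F D : Set (Set (Set ℕ))} {s X X' t₀ t : Set (Set ℕ)}
    (hF : IsPUltrafilter F) (hX : X ∈ F) (hneg : NoOneDense F D s X) (hX' : X' ∈ F)
    (hX'X : Coarser X' X) (ht₀ : FinPart t₀) (ht₀X : Coarser (sStar t₀) X)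
    (ht₀X' : Segment t₀ X') (ht : FinPart t) (hdom : pdom t = pdom t₀) :
    ∃ Y ∈ F, Y ∈ EllNbhd t₀ X' ∧ Killed D s t Y := by
  have hXi := hF.1.mem_infPart X hX
  have hXi' := hF.1.mem_infPart X' hX'
  by_cases hk : Killed D s t X'
  · exact ⟨X', hX', ⟨hXi', ht₀X', (coarser_inf hXi' hXi').2 fun _ _ h => h⟩, hk⟩
  unfold Killed at hk
  push Not at hk
  obtain ⟨r, hr, hrt, hst, htn, u, hu, htu, huX', hun, -⟩ := hk
  have hfb : finBound t = finBound t₀ := finBound_eq (hdom.trans ht₀.pdom_eq)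
  have htu' := (segment_fin ht hu).1 htu
  have htX' : Coarser t X' := by
    rw [coarser_fin_inf ht hXi']
    intro a ha b hb hab
    rw [coarser_fin_inf (finPart_sStar hu) hXi', finBound_sStar hu] at huX'
    have := huX' a (by omega) b (by omega) hab
    rw [sameBlock_sStar] at this
    rw [htu'.2 a ha b hb]
    exact this.resolve_right (by omega)
  have htX : Coarser (sStar t) X := by
    rw [coarser_fin_inf (finPart_sStar ht) hXi, finBound_sStar ht]
    intro a ha b hb hab
    rw [coarser_fin_inf (finPart_sStar ht₀) hXi, finBound_sStar ht₀, ← hfb] at ht₀X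
    have h1 := ht₀X a ha b hb hab
    rw [sameBlock_sStar] at h1 ⊢
    rw [← hfb] at h1
    refine h1.imp (fun h => ?_) id
    obtain ⟨h1, h2⟩ := ht₀.lt_of_sameBlock h
    rw [← hfb] at h1 h2
    exact (coarser_fin_inf ht hXi').1 htX' a h1 b h2 ((coarser_inf hXi' hXi).1 hX'X a b hab)
  obtain ⟨G, hG, hGi, htG, hGX'⟩ := exists_glue hF hX' ht htX'
  have hnd := hneg r hr t ⟨ht, htn, hst, htX⟩ hrt G
    ⟨hGi, htG, hGX'.trans_inf hGi hXi' hXi hX'X⟩ hG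
  unfold KDense at hnd
  push Not at hnd
  obtain ⟨Y, ⟨hYi, htY, hYG⟩, hY, hemp⟩ := hnd
  obtain ⟨W, hW, hWn, hWu⟩ := exists_unglue hF.1 hX' hY (hYG.trans_inf hYi hGi hXi' hGX') ht₀ ht
    hdom ht₀X' htY
  refine ⟨W, hW, hWn, fun r' _ _ _ _ u' hu' htu' huW hun' hsub => ?_⟩
  have : u' ∈ tseg s t Y 1 ∩ {u | FinPart u ∧ Segment t u ∧ iseg0 s u ⊆ D} :=
    ⟨⟨hu', htu'.trans_fin ht hu' (finPart_sStar hu') (segment_sStar hu'), hWu u' hu' htu' huW,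
      hun'⟩, hu', htu', hsub⟩
  rw [hemp] at this
  exact this

lemma exists_all_killed {F D : Set (Set (Set ℕ))} {s X X' t₀ : Set (Set ℕ)}
    (hF : IsPUltrafilter F) (hX : X ∈ F) (hneg : NoOneDense F D s X) (hX' : X' ∈ F)
    (hX'X : Coarser X' X) (ht₀ : FinPart t₀) (ht₀X : Coarser (sStar t₀) X)
    (ht₀X' : Segment t₀ X') :
    ∃ Y ∈ F, Y ∈ EllNbhd t₀ X' ∧ ∀ t, FinPart t → pdom t = pdom t₀ → Killed D s t Y := by
  have hi := hF.1.mem_infPart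
  have hfin : {t | FinPart t ∧ pdom t = pdom t₀}.Finite := by
    refine ((Set.finite_Iio (finBound t₀)).powerset.powerset).subset fun t ht b hb => ?_
    rw [Set.mem_powerset_iff, ← ht₀.pdom_eq, ← ht.2]
    exact Set.subset_sUnion_of_mem hb
  suffices H : ∀ T : Set (Set (Set ℕ)), T.Finite → T ⊆ {t | FinPart t ∧ pdom t = pdom t₀} →
      ∃ Y ∈ F, Y ∈ EllNbhd t₀ X' ∧ ∀ t ∈ T, Killed D s t Y by
    obtain ⟨Y, hY, hYn, h⟩ := H _ hfin subset_rfl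
    exact ⟨Y, hY, hYn, fun t ht hd => h t ⟨ht, hd⟩⟩
  intro T hT
  induction T, hT using Set.Finite.induction_on with
  | empty =>
    exact fun _ => ⟨X', hX', ⟨hi _ hX', ht₀X', (coarser_inf (hi _ hX') (hi _ hX')).2
      fun _ _ h => h⟩, by simp⟩
  | @insert t T _ _ ih =>
    intro hsub
    obtain ⟨Y, hY, ⟨_, ht₀Y, hYX'⟩, hall⟩ := ih ((Set.subset_insert _ _).trans hsub)
    obtain ⟨ht, hd⟩ := hsub (Set.mem_insert _ _)
    obtain ⟨W, hW, ⟨_, ht₀W, hWY⟩, hk⟩ := exists_killed hF hX hneg hY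
      (hYX'.trans_inf (hi _ hY) (hi _ hX') (hi _ hX) hX'X) ht₀ ht₀X ht₀Y ht hd
    refine ⟨W, hW, ⟨hi _ hW, ht₀W, hWY.trans_inf (hi _ hW) (hi _ hY) (hi _ hX') hYX'⟩, ?_⟩
    rintro v (rfl | hv)
    · exact hk
    · exact (hall v hv).mono (hi _ hY) (hi _ hW) hWY

/-- Every extension of `b` obtained from `Y` by absorbing blocks has a coarsening in `D`. -/
def Hits (D : Set (Set (Set ℕ))) (s b Y : Set (Set ℕ)) : Prop :=
  ∀ u, FinPart u → Segment b u → Coarser (sStar u) Y → u.ncard = b.ncard →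
    (iseg0 s u ∩ D).Nonempty

lemma exists_avoid_or_hits {F : Set (Set (Set ℕ))} (D : Set (Set (Set ℕ))) (s : Set (Set ℕ))
    {b X' : Set (Set ℕ)} (hF : IsPUltrafilter F) (hb : FinPart b) (hX' : X' ∈ F)
    (hbX' : Segment b X') :
    ∃ t Y, FinPart t ∧ Segment b t ∧ t.ncard = b.ncard ∧ Y ∈ F ∧ Segment (sStar t) Y ∧
      Coarser Y X' ∧ (iseg0 s t ∩ D = ∅ ∨ Hits D s b Y) := by
  have hi := hF.1.mem_infPart
  by_cases h : Hits D s b X'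
  · obtain ⟨t, ht, hbt, htn, htX'⟩ := exists_cut hb (hi _ hX') hbX'
    exact ⟨t, X', ht, hbt, htn, hX', htX', (coarser_inf (hi _ hX') (hi _ hX')).2 fun _ _ h => h,
      Or.inr h⟩
  · unfold Hits at h
    push Not at h
    obtain ⟨u, hu, hbu, huX', hun, hemp⟩ := h
    obtain ⟨Y, hY, _, huY, hYX'⟩ := exists_glue hF hX' (finPart_sStar hu) huX'
    exact ⟨u, Y, hu, hbu, hun, hY, huY, hYX', Or.inl hemp⟩

lemma exists_next {F D : Set (Set (Set ℕ))} {s X t X' : Set (Set ℕ)}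
    (hF : IsPUltrafilter F) (hX : X ∈ F) (hneg : NoOneDense F D s X) (ht : FinPart t)
    (hX' : X' ∈ F) (hX'X : Coarser X' X) (htX' : Segment (sStar t) X') :
    ∃ t' Y t₀, (FinPart t' ∧ Y ∈ F ∧ Segment (sStar t') Y ∧ Coarser Y X' ∧
      t'.ncard = t.ncard + 1) ∧ FinPart t₀ ∧ Segment (sStar t) t₀ ∧ Segment t₀ t' ∧
      (∀ v, FinPart v → pdom v = pdom t₀ → Killed D s v Y) ∧
      (iseg0 s t' ∩ D = ∅ ∨ Hits D s t₀ Y) := by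
  have hi := hF.1.mem_infPart
  obtain ⟨t₀, ht₀, htt₀, hn, ht₀X'⟩ := exists_cut (finPart_sStar ht) (hi _ hX') htX'
  have hs₀ := finPart_sStar ht₀
  obtain ⟨Y₁, hY₁, ⟨_, ht₀Y₁, hYX₁⟩, hk⟩ := exists_all_killed hF hX hneg hX' hX'X ht₀
    ((ht₀X'.coarser hs₀ (hi _ hX')).trans_fin hs₀ (hi _ hX') (hi _ hX) hX'X)
    ((segment_sStar ht₀).trans_inf ht₀ hs₀ (hi _ hX') ht₀X')
  obtain ⟨t', Y, ht', htt', hn', hY, htY, hYY₁, hor⟩ := exists_avoid_or_hits D s hF ht₀ hY₁ ht₀Y₁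
  exact ⟨t', Y, t₀, ⟨ht', hY, htY, hYY₁.trans_inf (hi _ hY) (hi _ hY₁) (hi _ hX') hYX₁,
    by rw [hn', hn, ncard_sStar ht]⟩, ht₀, htt₀, htt',
    fun v hv hd => (hk v hv hd).mono (hi _ hY₁) (hi _ hY) hYY₁, hor⟩

/-- A step relation player I can always follow admits an infinite run whose stems are initial
segments of a member of the game filter. -/
lemma GameFilter.exists_run {F : Set (Set (Set ℕ))} (hF : GameFilter F) {J : MoveI → Prop}
    {R : MoveI → MoveI → Prop} {m₀ : MoveI} (h₀ : J m₀)
    (hJ : ∀ m, J m → FinPart m.1 ∧ m.2 ∈ F ∧ Segment (sStar m.1) m.2)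
    (hstep : ∀ m, J m → ∀ X' ∈ F, X' ∈ EllNbhd (sStar m.1) m.2 → ∃ m', J m' ∧
      Coarser m'.2 X' ∧ Segment (sStar m.1) m'.1 ∧ m'.1.ncard = m.1.ncard + 1 ∧ R m m') :
    ∃ m : ℕ → MoveI, m 0 = m₀ ∧ (∀ n, J (m n)) ∧ (∀ n, Coarser (m (n + 1)).2 (m n).2) ∧
      (∀ n, Segment (sStar (m n).1) (m (n + 1)).1) ∧
      (∀ n, (m (n + 1)).1.ncard = (m n).1.ncard + 1) ∧ (∀ n, R (m n) (m (n + 1))) ∧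
      ∃ Z ∈ F, ∀ n, Segment (m n).1 Z := by
  have hi := hF.1.1.mem_infPart
  have hstep' : ∀ m X', ∃ m', J m → X' ∈ F → X' ∈ EllNbhd (sStar m.1) m.2 → J m' ∧
      Coarser m'.2 X' ∧ Segment (sStar m.1) m'.1 ∧ m'.1.ncard = m.1.ncard + 1 ∧ R m m' := by
    intro m X'
    by_cases h : J m ∧ X' ∈ F ∧ X' ∈ EllNbhd (sStar m.1) m.2
    · obtain ⟨m', hm'⟩ := hstep m h.1 X' h.2.1 h.2.2
      exact ⟨m', fun _ _ _ => hm'⟩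
    · exact ⟨m, fun h1 h2 h3 => (h ⟨h1, h2, h3⟩).elim⟩
  choose f hf using hstep'
  have hnot := hF.2 fun l => l.foldl f m₀
  unfold WinningStratI at hnot
  push Not at hnot
  obtain ⟨t, Y, X, hfol, hnot⟩ := hnot
  have hm0 : (t 0, Y 0) = m₀ := by simpa using (hfol 0).symm
  have hmsucc : ∀ n, (t (n + 1), Y (n + 1)) = f (t n, Y n) (X n) := fun n => by
    rw [← hfol n, ← hfol (n + 1), List.ofFn_succ']
    simp
  have hinv : ∀ n, (∀ m < n, LegalII F t Y X m) → J (t n, Y n) := by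
    intro n
    induction n with
    | zero => exact fun _ => hm0 ▸ h₀
    | succ n ih =>
      intro hl
      have hII := hl n (Nat.lt_succ_self n)
      rw [hmsucc]
      exact (hf _ _ (ih fun m hm => hl m (hm.trans (Nat.lt_succ_self n))) hII.1 hII.2).1
  have hrel : ∀ n, (∀ m < n + 1, LegalII F t Y X m) → Coarser (Y (n + 1)) (X n) ∧
      Segment (sStar (t n)) (t (n + 1)) ∧ (t (n + 1)).ncard = (t n).ncard + 1 ∧
      R (t n, Y n) (t (n + 1), Y (n + 1)) := by
    intro n hl
    have hII := hl n (Nat.lt_succ_self n)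
    have := (hf _ _ (hinv n fun m hm => hl m (hm.trans (Nat.lt_succ_self n))) hII.1 hII.2).2
    rwa [← hmsucc] at this
  obtain ⟨hII, Z, -, hZt, hZ⟩ := hnot fun n hl => by
    obtain ⟨ht, hY, htY⟩ := hJ _ (hinv n hl)
    refine ⟨ht, hY, ⟨Y n, hi _ hY, htY, (coarser_inf (hi _ hY) (hi _ hY)).2 fun _ _ h => h⟩, ?_⟩
    rintro m rfl
    obtain ⟨h1, h2, h3, -⟩ := hrel m hl
    have htm := (hJ _ (hinv m fun k hk => hl k (hk.trans (Nat.lt_succ_self m)))).1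
    have hXm := hi _ (hl m (Nat.lt_succ_self m)).1
    exact ⟨h2.trans_fin (finPart_sStar htm) ht (finPart_sStar ht) (segment_sStar ht),
      (htY.coarser (finPart_sStar ht) (hi _ hY)).trans_fin (finPart_sStar ht) (hi _ hY) hXm h1, h3⟩
  refine ⟨fun n => (t n, Y n), hm0, fun n => hinv n fun m _ => hII m, fun n => ?_,
    fun n => (hrel n fun m _ => hII m).2.1, fun n => (hrel n fun m _ => hII m).2.2.1,
    fun n => (hrel n fun m _ => hII m).2.2.2, Z, hZ, hZt⟩
  exact (hrel n fun m _ => hII m).1.trans_inf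
    (hi _ (hJ _ (hinv (n + 1) fun m _ => hII m)).2.1) (hi _ (hII n).1)
    (hi _ (hJ _ (hinv n fun m _ => hII m)).2.1) (hII n).2.2.2

lemma Segment.trans_coarser {p u Z : Set (Set ℕ)} (hp : FinPart p) (hu : FinPart u)
    (hZ : InfPart Z) (hpu : Segment p u) (huZ : Coarser u Z) : Coarser p Z := by
  rw [segment_fin hp hu] at hpu
  rw [coarser_fin_inf hu hZ] at huZ
  exact (coarser_fin_inf hp hZ).2 fun a ha b hb hab => (hpu.2 a ha b hb).2
    (huZ a (ha.trans_le hpu.1) b (hb.trans_le hpu.1) hab)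

lemma Coarser.not_sameBlock_finBound {v Z : Set (Set ℕ)} (hv : FinPart v) (hZ : InfPart Z)
    (hvZ : Coarser (sStar v) Z) {c : ℕ} (hc : c < finBound v) : ¬ sameBlock Z c (finBound v) := by
  intro h
  rw [coarser_fin_inf (finPart_sStar hv) hZ, finBound_sStar hv] at hvZ
  have := hvZ c (by omega) _ (Nat.lt_succ_self _) h
  rw [sameBlock_sStar] at this
  rcases this with h | h
  · exact (hv.lt_of_sameBlock h).2.ne rfl
  · omega

lemma exists_restrict {u : Set (Set ℕ)} (hu : FinPart u) {N : ℕ} (hN : N ≤ finBound u) :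
    ∃ t, FinPart t ∧ finBound t = N ∧ Segment t u := by
  refine ⟨ofFun (rep u) (Set.Iio N), finPart_ofFun _ _, finBound_ofFun _ _, ?_⟩
  rw [segment_fin (finPart_ofFun _ _) hu, finBound_ofFun]
  refine ⟨hN, fun a ha b hb => ?_⟩
  rw [sameBlock_ofFun, rep_eq_iff hu.1 (hu.refl (ha.trans_le hN)) (hu.refl (hb.trans_le hN))]
  exact ⟨fun h => h.2.2, fun h => ⟨ha, hb, h⟩⟩

/-- In a run of stems of `Z`, the minima of the blocks of `Z` outside the domain of `s` are exactly
the bounds of the stems. -/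
lemma exists_eq_finBound {s Z : Set (Set ℕ)} {t : ℕ → Set (Set ℕ)} (hs : FinPart s)
    (hZ : InfPart Z) (ht : ∀ n, FinPart (t n)) (hst : Segment s (t 0))
    (hcard : (t 0).ncard = s.ncard) (hseg : ∀ n, Segment (sStar (t n)) (t (n + 1)))
    (hsucc : ∀ n, (t (n + 1)).ncard = (t n).ncard + 1) (htZ : ∀ n, Segment (t n) Z)
    (hmono : StrictMono fun n => finBound (t n)) {e : ℕ} (hse : finBound s ≤ e)
    (he : ∀ c < e, ¬ sameBlock Z c e) : ∃ n, e = finBound (t n) := by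
  have hex : ∃ n, e < finBound (t n) := ⟨e + 1, hmono.le_apply (x := e + 1)⟩
  classical
  have hrel : ∀ n, e < finBound (t n) → ∀ c, sameBlock (t n) e c → e ≤ c := by
    intro n hn c hec
    refine not_lt.1 fun hc => he c hc (sameBlock_symm ?_)
    exact ((segment_inf (ht n) hZ).1 (htZ n) e hn c (hc.trans hn)).1 hec
  rcases hn : Nat.find hex with _ | n
  · have h := Nat.find_spec hex
    rw [hn] at h
    obtain ⟨c, hc, hec⟩ := (ncard_eq_iff hs (ht 0) hst).1 hcard e h
    have := hrel 0 h c hec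
    omega
  · have h := Nat.find_spec hex
    rw [hn] at h
    have h2 := Nat.find_min hex (show n < Nat.find hex by omega)
    obtain ⟨c, hc, hec⟩ := (ncard_eq_iff (finPart_sStar (ht n)) (ht (n + 1)) (hseg n)).1
      ((hsucc n).trans (ncard_sStar (ht n)).symm) e h
    have := hrel (n + 1) h c hec
    rw [finBound_sStar (ht n)] at hc
    exact ⟨n, by omega⟩

lemma coarser_of_forall_segment {Z : Set (Set ℕ)} {t Y : ℕ → Set (Set ℕ)} (hZ : InfPart Z)
    (ht : ∀ n, FinPart (t n)) (hY : ∀ n, InfPart (Y n)) (htY : ∀ n, Segment (sStar (t n)) (Y n))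
    (hYY : ∀ n, Coarser (Y (n + 1)) (Y n)) (htZ : ∀ n, Segment (t n) Z)
    (hmono : StrictMono fun n => finBound (t n)) (n : ℕ) : Coarser Z (Y n) := by
  rw [coarser_inf hZ (hY n)]
  intro a b hab
  have hYm : ∀ m, n ≤ m → sameBlock (Y m) a b := fun m hm => by
    induction m, hm using Nat.le_induction with
    | base => exact hab
    | succ m _ ih => exact (coarser_inf (hY _) (hY _)).1 (hYY m) a b ih
  set m := max n (max (a + 1) (b + 1))
  have hm : m ≤ finBound (t m) := hmono.le_apply
  have ha : a < finBound (t m) := by omega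
  have hb : b < finBound (t m) := by omega
  rw [← (segment_inf (ht m) hZ).1 (htZ m) a ha b hb]
  exact ((segment_inf (ht m) (hY m)).1 ((segment_sStar (ht m)).trans_inf (ht m)
    (finPart_sStar (ht m)) (hY m) (htY m)) a ha b hb).2 (hYm m (le_max_left _ _))

lemma finBound_eq_zero {s v : Set (Set ℕ)} (hs : FinPart s) (hv : FinPart v) (hsv : Segment s v)
    (hcard : v.ncard = s.ncard) (h₀ : finBound s = 0) : finBound v = 0 := by
  by_contra h
  obtain ⟨c, hc, -⟩ := (ncard_eq_iff hs hv hsv).1 hcard 0 (Nat.pos_of_ne_zero h)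
  omega

lemma not_noOneDense {F : Set (Set (Set ℕ))} (hF : GameFilter F) {s X : Set (Set ℕ)}
    (hs : FinPart s) (hX : X ∈ F) (hsX : Segment s X) {D : Set (Set (Set ℕ))}
    (hD : D ⊆ nsegOmega s s.ncard) (hdense : ZeroDense F D s X) : ¬ NoOneDense F D s X := by
  intro hneg
  have hi := hF.1.1.mem_infPart
  obtain ⟨t₀, Y₀, ht₀, hst₀, hn₀, hY₀, htY₀, hYX₀, hor₀⟩ := exists_avoid_or_hits D s hF.1 hs hX hsX
  obtain ⟨m, hm0, hJ, hYY, hseg, hsucc, hR, Z, hZ, htZ⟩ := hF.exists_run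
    (J := fun m => (FinPart m.1 ∧ m.2 ∈ F ∧ Segment (sStar m.1) m.2) ∧ Coarser m.2 X)
    (R := fun m m' => ∃ b, FinPart b ∧ Segment (sStar m.1) b ∧ Segment b m'.1 ∧
      (∀ v, FinPart v → pdom v = pdom b → Killed D s v m'.2) ∧
      (iseg0 s m'.1 ∩ D = ∅ ∨ Hits D s b m'.2)) (m₀ := (t₀, Y₀))
    ⟨⟨ht₀, hY₀, htY₀⟩, hYX₀⟩ (fun _ h => h.1) (by
      rintro ⟨t, Y⟩ ⟨⟨ht, hY, htY⟩, hYX⟩ X' hX' ⟨_, htX', hX'Y⟩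
      have hX'X := hX'Y.trans_inf (hi _ hX') (hi _ hY) (hi _ hX) hYX
      obtain ⟨t', Y', b, ⟨ht', hY', htY', hYX', hcard⟩, hb, htb, hbt', hk, hor⟩ :=
        exists_next hF.1 hX hneg ht hX' hX'X htX'
      exact ⟨(t', Y'), ⟨⟨ht', hY', htY'⟩, hYX'.trans_inf (hi _ hY') (hi _ hX') (hi _ hX) hX'X⟩,
        hYX', (htb.trans_fin (finPart_sStar ht) hb ht' hbt'), hcard, b, hb, htb, hbt', hk, hor⟩)
  have hZi := hi _ hZ
  have ht : ∀ n, FinPart (m n).1 := fun n => (hJ n).1.1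
  have hYi : ∀ n, InfPart (m n).2 := fun n => hi _ (hJ n).1.2.1
  have hst : Segment s (m 0).1 := by rwa [hm0]
  have hcard : (m 0).1.ncard = s.ncard := by rwa [hm0]
  have hmono : StrictMono fun n => finBound (m n).1 := strictMono_nat_of_lt_succ fun n => by
    have := ((segment_fin (finPart_sStar (ht n)) (ht (n + 1))).1 (hseg n)).1
    rw [finBound_sStar (ht n)] at this
    omega
  have hZY : ∀ n, Coarser Z (m n).2 := coarser_of_forall_segment (t := fun n => (m n).1)
    (Y := fun n => (m n).2) hZi ht hYi (fun n => (hJ n).1.2.2) hYY htZ hmono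
  have hmin : ∀ v, FinPart v → Segment s v → Coarser (sStar v) Z →
      ∃ n, finBound v = finBound (m n).1 :=
    fun v hv hsv hvZ => exists_eq_finBound (t := fun n => (m n).1) hs hZi ht hst hcard hseg hsucc
      htZ hmono ((segment_fin hs hv).1 hsv).1 fun c hc => hvZ.not_sameBlock_finBound hv hZi hc
  have hkill : ∀ r ∈ D, ∀ u, FinPart u → Segment (sStar r) u → Segment s u →
      Coarser (sStar u) Z → u.ncard = s.ncard + 1 → ¬ iseg0 s u ⊆ D := by
    intro r hr u hu hru hsu huZ hun
    obtain ⟨hrf, hrn, hsr⟩ := hD hr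
    have hr' := finPart_sStar hrf
    have hu' := finPart_sStar hu
    obtain ⟨i, hri⟩ := hmin r hrf hsr ((hru.trans_fin hr' hu hu' (segment_sStar hu)).trans_coarser
      hr' hu' hZi huZ)
    obtain ⟨j, huj⟩ := hmin u hu hsu huZ
    obtain ⟨b, hb, hib, hbi, hk, -⟩ := hR i
    have hru' := (segment_fin hr' hu).1 hru
    have h1 := hru'.1
    have h2 := ((segment_fin (finPart_sStar (ht i)) hb).1 hib).1
    have h3 := ((segment_fin hb (ht (i + 1))).1 hbi).1
    rw [finBound_sStar hrf] at h1
    rw [finBound_sStar (ht i)] at h2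
    have hij : i < j := hmono.lt_iff_lt.1 (show finBound (m i).1 < finBound (m j).1 by omega)
    have h4 : finBound (m (i + 1)).1 ≤ finBound (m j).1 := hmono.monotone hij
    obtain ⟨t, htf, htb, htu⟩ := exists_restrict hu (show finBound b ≤ finBound u by omega)
    have htu' := (segment_fin htf hu).1 htu
    have hrt_le : finBound (sStar r) ≤ finBound t := by
      rw [finBound_sStar hrf]
      omega
    have hle : ∀ {p}, FinPart p → Segment p u → finBound p ≤ finBound t → Segment p t :=
      fun {p} hp hpu hpt => (segment_fin hp htf).2 ⟨hpt, fun a ha c hc =>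
        (((segment_fin hp hu).1 hpu).2 a ha c hc).trans
          (htu'.2 a (ha.trans_le hpt) c (hc.trans_le hpt)).symm⟩
    have hrt := hle hr' hru hrt_le
    have hsrb := ((segment_fin hs hrf).1 hsr).1
    have htn : t.ncard = s.ncard + 1 := by
      rw [← hrn, ← ncard_sStar hrf, ncard_eq_iff hr' htf hrt]
      intro a ha
      obtain ⟨c, hc, hac⟩ := (ncard_eq_iff hr' hu hru).1
        (hun.trans (by rw [ncard_sStar hrf, hrn])) a (ha.trans_le htu'.1)
      exact ⟨c, hc, (htu'.2 a ha c (hc.trans_le hrt_le)).2 hac⟩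
    exact (hk t htf (by rw [htf.pdom_eq, hb.pdom_eq, htb])).mono (hYi _) hZi (hZY _) r hr hrt
      (hle hs hsu (by omega)) htn u hu htu huZ hun
  obtain ⟨v, hvD, -, hvZ⟩ := hdense Z ⟨hZi, hst.trans_inf hs (ht 0) hZi (htZ 0),
    (hZY 0).trans_inf hZi (hYi 0) (hi _ hX) (hJ 0).2⟩ hZ
  obtain ⟨hv, hvn, hsv⟩ := hD hvD
  obtain ⟨n, hvt⟩ := hmin v hv hsv hvZ
  rcases Nat.eq_zero_or_pos (finBound s) with h₀ | hpos
  · have hv0 := finBound_eq_zero hs hv hsv hvn h₀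
    have ht1 := ht 1
    have hpos1 : 0 < finBound (m 1).1 := (Nat.zero_le _).trans_lt (hmono Nat.zero_lt_one)
    have hs1 : Segment s (m 1).1 := (hst.trans_fin hs (ht 0) (finPart_sStar (ht 0))
      (segment_sStar (ht 0))).trans_fin hs (finPart_sStar (ht 0)) ht1 (hseg 0)
    refine hkill v hvD _ ht1 ?_ hs1 ?_ (by rw [hsucc 0, hcard]) ?_
    · rw [segment_fin (finPart_sStar hv) ht1, finBound_sStar hv, hv0]
      refine ⟨hpos1, fun a ha c hc => ?_⟩
      obtain rfl : a = 0 := by omega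
      obtain rfl : c = 0 := by omega
      rw [sameBlock_sStar, hv0]
      exact ⟨fun _ => ht1.refl hpos1, fun _ => Or.inr ⟨rfl, rfl⟩⟩
    · exact ((hseg 1).trans_inf (finPart_sStar ht1) (ht 2) hZi (htZ 2)).coarser
        (finPart_sStar ht1) hZi
    · rintro w ⟨hw, hdom, hsw, -, hwn⟩
      have := finBound_eq_zero hs hw hsw hwn h₀
      rw [finBound_eq (hdom.trans ht1.pdom_eq)] at this
      omega
  · have hvmem : (iseg0 s (m n).1 ∩ D).Nonempty := by
      have hdom : pdom v = pdom (m n).1 := by rw [hv.pdom_eq, (ht n).pdom_eq, hvt]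
      refine ⟨v, ⟨hv, hdom, hsv, ?_, hvn⟩, hvD⟩
      rw [coarser_fin hv (ht n) hdom]
      intro a c hac
      obtain ⟨ha, hc⟩ := (ht n).lt_of_sameBlock hac
      exact (coarser_fin_inf hv hZi).1 ((segment_sStar hv).trans_coarser hv (finPart_sStar hv) hZi
        hvZ) a (by omega) c (by omega)
        (((segment_inf (ht n) hZi).1 (htZ n) a ha c hc).1 hac)
    have hbase : ∃ b, FinPart b ∧ Segment s b ∧ Segment b (m n).1 ∧
        (iseg0 s (m n).1 ∩ D = ∅ ∨ Hits D s b (m n).2) := by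
      rcases n with _ | n
      · rw [hm0]
        exact ⟨s, hs, (segment_fin hs hs).2 ⟨le_rfl, fun _ _ _ _ => Iff.rfl⟩, hst₀, hor₀⟩
      · obtain ⟨b, hb, hib, hbi, -, hor⟩ := hR n
        have hsn : Segment s (m n).1 := by
          clear * - hs ht hst hseg
          induction n with
          | zero => exact hst
          | succ n ih => exact (ih.trans_fin hs (ht n) (finPart_sStar (ht n))
              (segment_sStar (ht n))).trans_fin hs (finPart_sStar (ht n)) (ht (n + 1)) (hseg n)
        exact ⟨b, hb, (hsn.trans_fin hs (ht n) (finPart_sStar (ht n))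
          (segment_sStar (ht n))).trans_fin hs (finPart_sStar (ht n)) hb hib, hbi, hor⟩
    obtain ⟨b, hb, hsb, hbn, hor⟩ := hbase
    have hhits := hor.resolve_left hvmem.ne_empty
    obtain ⟨r, hr, u, hu, hru, hsu, huZ, hun, hsub⟩ := exists_line_of_hit hs hb hZi hsb
      (hbn.trans_inf hb (ht n) hZi (htZ n)) hpos hD fun u hu hbu huZ hun => hhits u hu hbu
        (huZ.trans_fin (finPart_sStar hu) hZi (hYi n) (hZY n)) hun
    exact hkill r hr u hu hru hsu huZ hun hsub

theorem lemma_l67 (F : Set (Set (Set ℕ))) (hF : GameFilter F)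
    (s X : Set (Set ℕ)) (hs : FinPart s) (hX : X ∈ F) (hsX : Segment s X)
    (D : Set (Set (Set ℕ))) (hD : D ⊆ nsegOmega s s.ncard)
    (hdense : ZeroDense F D s X) :
    ∃ r, ∃ t ∈ nseg s X (s.ncard + 1), FinPart r ∧ Segment (sStar r) t ∧ r ∈ D ∧
      ∃ Y ∈ EllNbhd t X, Y ∈ F ∧
        KDense F {u | FinPart u ∧ Segment t u ∧ iseg0 s u ⊆ D} s t Y 1 := by
  by_contra h
  exact not_noOneDense hF hs hX hsX hD hdense fun r hr t ht hrt Y hY hYF hK =>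
    h ⟨r, t, ht, (hD hr).1, hrt, hr, Y, hY, hYF, hK⟩

end DualRamsey
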